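/- Let (g,c,m) be an e-admissible triplet. (1) If either g = c, or g < c and m ≥ c + g/4, then β(g,c,m) = c/4. (2) If g < c and m < c + g/4, then β(g,c,m) = m - (g + 3c)/4. -/

import Mathlib

open SimpleGraph Set

/-- Auxiliary distance on representations of points of the metric graph:
a point is represented by `(u, v, t)` with `u, v` adjacent and `t ∈ [0,1]`,
meaning the point on the edge `[u,v]` at distance `t` from `u`. -/
noncomputable def mgDistAux {V : Type} [Fintype V] [DecidableEq V] (G : SimpleGraph V)
    (p q : V × V × ℝ) : ℝ :=
  min
    (min (if p.1 = q.1 ∧ p.2.1 = q.2.1 then |p.2.2 - q.2.2| else (Fintype.card V : ℝ) + 1)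
         (if p.1 = q.2.1 ∧ p.2.1 = q.1 then |p.2.2 - (1 - q.2.2)| else (Fintype.card V : ℝ) + 1))
    (min (min (p.2.2 + (G.dist p.1 q.1 : ℝ) + q.2.2)
              (p.2.2 + (G.dist p.1 q.2.1 : ℝ) + (1 - q.2.2)))
         (min ((1 - p.2.2) + (G.dist p.2.1 q.1 : ℝ) + q.2.2)
              ((1 - p.2.2) + (G.dist p.2.1 q.2.1 : ℝ) + (1 - q.2.2))))

/-- The points of the metric graph associated to a simple graph `G`:
the vertices together with the interior points of the edges. -/
def MGPoint {V : Type} (G : SimpleGraph V) : Type :=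
  {p : V × V × ℝ // G.Adj p.1 p.2.1 ∧ p.2.2 ∈ Set.Icc (0 : ℝ) 1}

/-- The shortest-path distance on the metric graph associated to `G`
(every edge has length 1). -/
noncomputable def mgDist {V : Type} [Fintype V] [DecidableEq V] (G : SimpleGraph V)
    (p q : MGPoint G) : ℝ := mgDistAux G p.1 q.1

/-- Distance from a vertex `v` to a point of the metric graph. -/
noncomputable def mgVDist {V : Type} [Fintype V] [DecidableEq V] (G : SimpleGraph V)
    (v : V) (x : MGPoint G) : ℝ :=
  min ((G.dist v x.1.1 : ℝ) + x.1.2.2) ((G.dist v x.1.2.1 : ℝ) + (1 - x.1.2.2))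

/-- `γ` restricted to `[a,b]` is a geodesic in the metric graph of `G`
(an arc-length parametrization realizing distances). -/
def IsMGGeodesic {V : Type} [Fintype V] [DecidableEq V] (G : SimpleGraph V)
    (a b : ℝ) (γ : ℝ → MGPoint G) : Prop :=
  a ≤ b ∧ ∀ s ∈ Set.Icc a b, ∀ t ∈ Set.Icc a b, mgDist G (γ s) (γ t) = |s - t|

/-- A geodesic triangle in the metric graph of `G`: three geodesic sides whose
endpoints match cyclically (distance `0` means equality of points). -/
structure MGTriangle {V : Type} [Fintype V] [DecidableEq V] (G : SimpleGraph V) where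
  a1 : ℝ
  b1 : ℝ
  a2 : ℝ
  b2 : ℝ
  a3 : ℝ
  b3 : ℝ
  g1 : ℝ → MGPoint G
  g2 : ℝ → MGPoint G
  g3 : ℝ → MGPoint G
  h1 : IsMGGeodesic G a1 b1 g1
  h2 : IsMGGeodesic G a2 b2 g2
  h3 : IsMGGeodesic G a3 b3 g3
  glue1 : mgDist G (g1 b1) (g2 a2) = 0
  glue2 : mgDist G (g2 b2) (g3 a3) = 0
  glue3 : mgDist G (g3 b3) (g1 a1) = 0

/-- The sharp thin constant `δ(T)` of a geodesic triangle: the infimum of the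
`d ≥ 0` such that each side is contained in the `d`-neighborhood of the union of
the other two sides. -/
noncomputable def triangleDelta {V : Type} [Fintype V] [DecidableEq V] {G : SimpleGraph V}
    (T : MGTriangle G) : ℝ :=
  sInf {d : ℝ | 0 ≤ d ∧
    (∀ s ∈ Set.Icc T.a1 T.b1,
      (∃ t ∈ Set.Icc T.a2 T.b2, mgDist G (T.g1 s) (T.g2 t) ≤ d) ∨
      (∃ t ∈ Set.Icc T.a3 T.b3, mgDist G (T.g1 s) (T.g3 t) ≤ d)) ∧
    (∀ s ∈ Set.Icc T.a2 T.b2,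
      (∃ t ∈ Set.Icc T.a1 T.b1, mgDist G (T.g2 s) (T.g1 t) ≤ d) ∨
      (∃ t ∈ Set.Icc T.a3 T.b3, mgDist G (T.g2 s) (T.g3 t) ≤ d)) ∧
    (∀ s ∈ Set.Icc T.a3 T.b3,
      (∃ t ∈ Set.Icc T.a1 T.b1, mgDist G (T.g3 s) (T.g1 t) ≤ d) ∨
      (∃ t ∈ Set.Icc T.a2 T.b2, mgDist G (T.g3 s) (T.g2 t) ≤ d))}

/-- The hyperbolicity constant `δ(G)`: the supremum of `δ(T)` over all geodesic
triangles `T` in the metric graph of `G`. -/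
noncomputable def hypDelta {V : Type} [Fintype V] [DecidableEq V] (G : SimpleGraph V) : ℝ :=
  sSup {d : ℝ | ∃ T : MGTriangle G, d = triangleDelta T}

/-- The circumference of `G`: the length of a longest cycle. -/
noncomputable def circumference {V : Type} (G : SimpleGraph V) : ℕ :=
  sSup {n : ℕ | ∃ (a : V) (w : G.Walk a a), w.IsCycle ∧ w.length = n}

/-- `G` belongs to the class `𝒢(g,c,n)` of (connected) graphs with girth `g`,
circumference `c` and `n` vertices (vertex set `Fin n`). -/
def memGclass (g c : ℕ) {n : ℕ} (G : SimpleGraph (Fin n)) : Prop :=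
  G.Connected ∧ G.girth = g ∧ circumference G = c

/-- `A(g,c,n) = min {δ(G) : G ∈ 𝒢(g,c,n)}`. -/
noncomputable def Agcn (g c n : ℕ) : ℝ :=
  sInf {d : ℝ | ∃ G : SimpleGraph (Fin n), memGclass g c G ∧ d = hypDelta G}

/-- `B(g,c,n) = max {δ(G) : G ∈ 𝒢(g,c,n)}`. -/
noncomputable def Bgcn (g c n : ℕ) : ℝ :=
  sSup {d : ℝ | ∃ G : SimpleGraph (Fin n), memGclass g c G ∧ d = hypDelta G}

/-- `G` belongs to the class `ℋ(g,c,m)` of (connected) graphs with girth `g`,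
circumference `c` and `m` edges. -/
def memHclass (g c m : ℕ) {k : ℕ} (G : SimpleGraph (Fin k)) : Prop :=
  G.Connected ∧ G.girth = g ∧ circumference G = c ∧ G.edgeSet.ncard = m

/-- `α(g,c,m) = min {δ(G) : G ∈ ℋ(g,c,m)}`. -/
noncomputable def alphagcm (g c m : ℕ) : ℝ :=
  sInf {d : ℝ | ∃ (k : ℕ) (G : SimpleGraph (Fin k)), memHclass g c m G ∧ d = hypDelta G}

/-- `β(g,c,m) = max {δ(G) : G ∈ ℋ(g,c,m)}`. -/
noncomputable def betagcm (g c m : ℕ) : ℝ :=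
  sSup {d : ℝ | ∃ (k : ℕ) (G : SimpleGraph (Fin k)), memHclass g c m G ∧ d = hypDelta G}



set_option linter.unusedSectionVars false
set_option linter.unusedDecidableInType false
set_option linter.unusedFintypeInType false

section combi
variable {V : Type} [Fintype V] [DecidableEq V] {G : SimpleGraph V}

/-- A cycle of length `L` presented by the sequence of its vertices. -/
def IsCyc (G : SimpleGraph V) (L : ℕ) (f : ℕ → V) : Prop :=
  3 ≤ L ∧ (∀ i < L, G.Adj (f i) (f (i + 1))) ∧ f L = f 0 ∧
    ∀ i < L, ∀ j < L, f i = f j → i = j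

/-- Edges of a cyclic sequence. -/
def cycE (L : ℕ) (f : ℕ → V) : Finset (Sym2 V) :=
  (Finset.range L).image (fun i => s(f i, f (i + 1)))

lemma seq_walk (f : ℕ → V) (n : ℕ) : ∀ i : ℕ, (∀ j < n, G.Adj (f (i + j)) (f (i + j + 1))) →
    ∃ w : G.Walk (f i) (f (i + n)), w.length = n ∧ (∀ j ≤ n, w.getVert j = f (i + j)) ∧
      ∀ e ∈ w.edges, ∃ j < n, e = s(f (i + j), f (i + j + 1)) := by
  induction n with
  | zero => intro i _; exact ⟨Walk.nil, rfl, by simp, by simp⟩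
  | succ n ih =>
    intro i h
    have h0 := h 0 (by omega)
    obtain ⟨w, hl, hv, he⟩ := ih (i + 1) (fun j hj => by
      have := h (j + 1) (by omega)
      rwa [show i + (j + 1) = i + 1 + j by ring] at this)
    have e1 : i + 1 + n = i + (n + 1) := by ring
    refine ⟨(Walk.cons h0 w).copy rfl (by rw [e1]), by simp [hl], ?_, ?_⟩
    · intro j hj
      cases j with
      | zero => simp
      | succ j =>
        simp only [Walk.getVert_copy, Walk.getVert_cons_succ]
        have := hv j (by omega)
        rw [show i + (j + 1) = i + 1 + j by ring]; exact this
    · intro e hee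
      simp only [Walk.edges_copy, Walk.edges_cons, List.mem_cons] at hee
      rcases hee with rfl | hee
      · exact ⟨0, by omega, rfl⟩
      · obtain ⟨j, hj, rfl⟩ := he e hee
        exact ⟨j + 1, by omega, by rw [show i + (j + 1) = i + 1 + j by ring]⟩

lemma IsCyc.edge_inj {L : ℕ} {f : ℕ → V} (h : IsCyc G L f) {i j : ℕ} (hi : i < L) (hj : j < L)
    (he : s(f i, f (i + 1)) = s(f j, f (j + 1))) : i = j := by
  obtain ⟨h3, hadj, hcl, hinj⟩ := h
  rw [Sym2.eq_iff] at he
  rcases he with ⟨h1, -⟩ | ⟨h1, h2⟩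
  · exact hinj i hi j hj h1
  · have key : ∀ a < L, ∀ b < L, f a = f (b + 1) → (a = b + 1 ∨ (a = 0 ∧ b + 1 = L)) := by
      intro a ha b hb hab
      by_cases hbL : b + 1 < L
      · exact Or.inl (hinj a ha _ hbL hab)
      · have : b + 1 = L := by omega
        rw [this, hcl] at hab
        exact Or.inr ⟨hinj a ha 0 (by omega) hab, this⟩
    have k1 := key i hi j hj h1
    have k2 := key j hj i hi h2.symm
    omega

lemma IsCyc.card_cycE {L : ℕ} {f : ℕ → V} (h : IsCyc G L f) : (cycE L f).card = L := by
  rw [cycE, Finset.card_image_of_injOn, Finset.card_range]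
  intro i hi j hj he
  simp only [Finset.coe_range, Set.mem_Iio] at hi hj
  exact h.edge_inj hi hj he

lemma mem_cycE {L : ℕ} {f : ℕ → V} {e : Sym2 V} :
    e ∈ cycE L f ↔ ∃ i < L, s(f i, f (i + 1)) = e := by
  simp [cycE]

lemma IsCyc.cycE_sub {L : ℕ} {f : ℕ → V} (h : IsCyc G L f) :
    ∀ e ∈ cycE L f, e ∈ G.edgeSet := by
  intro e he
  obtain ⟨i, hi, rfl⟩ := mem_cycE.1 he
  exact h.2.1 i hi

lemma IsCyc.exists_walk {L : ℕ} {f : ℕ → V} (h : IsCyc G L f) :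
    ∃ (a : V) (w : G.Walk a a), w.IsCycle ∧ w.length = L := by
  have hh := h
  obtain ⟨h3, hadj, hcl, hinj⟩ := h
  obtain ⟨w, hl, hv, he⟩ := seq_walk (G := G) f (L - 1) 1 (fun j hj => by
    have := hadj (1 + j) (by omega); exact this)
  have e1 : f (1 + (L - 1)) = f 0 := by rw [show 1 + (L - 1) = L by omega, hcl]
  have hp : w.IsPath := by
    rw [← Walk.IsPath.getVert_injOn_iff]
    intro i hi j hj hij
    simp only [Set.mem_ofPred_eq, hl] at hi hj
    rw [hv i hi, hv j hj] at hij
    by_cases ci : 1 + i < L <;> by_cases cj : 1 + j < L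
    · have := hinj _ ci _ cj hij; omega
    · rw [show 1 + j = L by omega, hcl] at hij
      have := hinj _ ci 0 (by omega) hij; omega
    · rw [show 1 + i = L by omega, hcl] at hij
      have := hinj 0 (by omega) _ cj hij; omega
    · omega
  refine ⟨f 0, Walk.cons (hadj 0 (by omega)) (w.copy rfl e1), ?_, by simp [hl]; omega⟩
  rw [Walk.cons_isCycle_iff]
  refine ⟨by simpa using hp, ?_⟩
  rw [Walk.edges_copy]
  intro hmem
  obtain ⟨j, hj, hje⟩ := he _ hmem
  have := hh.edge_inj (i := 0) (j := 1 + j) (by omega) (by omega) hje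
  omega

lemma isCyc_of_walk {a : V} {w : G.Walk a a} (hw : w.IsCycle) : IsCyc G w.length w.getVert := by
  refine ⟨hw.three_le_length, fun i hi => w.adj_getVert_succ hi, by simp, ?_⟩
  intro i hi j hj hij
  exact hw.getVert_injOn' (by simp; omega) (by simp; omega) hij

lemma IsCyc.le_card {L : ℕ} {f : ℕ → V} (h : IsCyc G L f) : L ≤ Fintype.card V := by
  have : (Finset.range L).card ≤ (Finset.univ : Finset V).card := by
    apply Finset.card_le_card_of_injOn f (by simp)
    intro i hi j hj hij
    simp only [Finset.coe_range, Set.mem_Iio] at hi hj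
    exact h.2.2.2 i hi j hj hij
  simpa using this

lemma IsCyc.girth_le {L : ℕ} {f : ℕ → V} (h : IsCyc G L f) : G.girth ≤ L := by
  obtain ⟨a, w, hw, rfl⟩ := h.exists_walk
  exact G.girth_le_length hw

lemma circ_bdd : BddAbove {n : ℕ | ∃ (a : V) (w : G.Walk a a), w.IsCycle ∧ w.length = n} := by
  refine ⟨Fintype.card V, ?_⟩
  rintro n ⟨a, w, hw, rfl⟩
  exact (isCyc_of_walk hw).le_card

lemma IsCyc.le_circ {L : ℕ} {f : ℕ → V} (h : IsCyc G L f) : L ≤ circumference G :=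
  le_csSup circ_bdd h.exists_walk

lemma exists_cyc_circ (h : 0 < circumference G) : ∃ f, IsCyc G (circumference G) f := by
  have hne : {n : ℕ | ∃ (a : V) (w : G.Walk a a), w.IsCycle ∧ w.length = n}.Nonempty := by
    by_contra hcon
    rw [Set.not_nonempty_iff_eq_empty] at hcon
    rw [circumference, hcon] at h
    simp at h
  obtain ⟨a, w, hw, hl⟩ := Nat.sSup_mem hne circ_bdd
  have := isCyc_of_walk hw
  rw [hl] at this
  exact ⟨_, this⟩

lemma exists_cyc_girth (h : 0 < G.girth) : ∃ f, IsCyc G G.girth f := by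
  have : ¬ G.IsAcyclic := fun hh => by rw [hh.girth_eq_zero] at h; omega
  obtain ⟨a, w, hw, hl⟩ := exists_girth_eq_length.2 this
  rw [hl]
  exact ⟨_, isCyc_of_walk hw⟩

/-- If `e = s(x,y)` is in `D` and `x`, `y` are still connected by `D` minus `e`, there is a cycle
inside `D`. -/
lemma girth_le_of_reach {D : Finset (Sym2 V)} (hD : ∀ e ∈ D, e ∈ G.edgeSet) {x y : V}
    (he : s(x, y) ∈ D) (hr : (fromEdgeSet ((D : Set (Sym2 V)) \ {s(x, y)})).Reachable y x) :
    G.girth ≤ D.card := by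
  set H := fromEdgeSet ((D : Set (Sym2 V)) \ {s(x, y)}) with hH
  have hle : H ≤ G := by
    intro a b hab
    rw [hH, fromEdgeSet_adj] at hab
    exact hD _ hab.1.1
  obtain ⟨p, hp⟩ := hr.exists_isPath
  have hedges : ∀ e ∈ p.edges, e ∈ D ∧ e ≠ s(x, y) := by
    intro e hee
    have := p.edges_subset_edgeSet hee
    rw [hH, edgeSet_fromEdgeSet] at this
    exact ⟨this.1.1, this.1.2⟩
  have hcyc : (Walk.cons (show G.Adj x y from hD _ he) (p.mapLe hle)).IsCycle := by
    rw [Walk.cons_isCycle_iff]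
    refine ⟨by simpa using hp, ?_⟩
    intro hm
    rw [Walk.edges_mapLe_eq_edges] at hm
    exact (hedges _ hm).2 rfl
  have h1 := G.girth_le_length hcyc
  have h2 : p.edges.toFinset ⊆ D.erase s(x, y) := by
    intro e hee
    rw [List.mem_toFinset] at hee
    rw [Finset.mem_erase]
    exact ⟨(hedges e hee).2, (hedges e hee).1⟩
  have h3 := Finset.card_le_card h2
  rw [List.toFinset_card_of_nodup hp.isTrail.edges_nodup, Walk.length_edges,
    Finset.card_erase_of_mem he] at h3
  have h4 : 0 < D.card := Finset.card_pos.2 ⟨_, he⟩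
  simp at h1
  omega

lemma length_le_of_fromEdgeSet {D : Finset (Sym2 V)} {x y : V}
    {p : (fromEdgeSet (D : Set (Sym2 V))).Walk x y} (hp : p.IsPath) : p.length ≤ D.card := by
  rw [← Walk.length_edges, ← List.toFinset_card_of_nodup hp.isTrail.edges_nodup]
  apply Finset.card_le_card
  intro e hee
  rw [List.mem_toFinset] at hee
  have := p.edges_subset_edgeSet hee
  rw [edgeSet_fromEdgeSet] at this
  exact this.1

/-- Edges crossing a cut. -/
def crossing (φ : V → Prop) (e : Sym2 V) : Prop := ∃ x y, e = s(x, y) ∧ φ x ∧ ¬ φ y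

lemma crossing_iff (φ : V → Prop) (x y : V) : crossing φ s(x, y) ↔ ¬ (φ x ↔ φ y) := by
  constructor
  · rintro ⟨a, b, hab, ha, hb⟩
    rw [Sym2.eq_iff] at hab
    rcases hab with ⟨rfl, rfl⟩ | ⟨rfl, rfl⟩ <;> tauto
  · intro h
    by_cases hx : φ x
    · exact ⟨x, y, rfl, hx, by tauto⟩
    · exact ⟨y, x, Sym2.eq_swap, by tauto, hx⟩

open Classical in
lemma seq_parity (φ : V → Prop) (f : ℕ → V) (n : ℕ) :
    Even ((Finset.range n).filter (fun i => ¬ (φ (f i) ↔ φ (f (i + 1))))).card ↔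
      (φ (f 0) ↔ φ (f n)) := by
  induction n with
  | zero => simp
  | succ n ih =>
    rw [Finset.range_add_one, Finset.filter_insert]
    split_ifs with h
    · rw [ih]; tauto
    · rw [Finset.card_insert_of_notMem (by simp), Nat.even_add_one, ih]; tauto

open Classical in
lemma IsCyc.parity {L : ℕ} {f : ℕ → V} (h : IsCyc G L f) (φ : V → Prop) :
    Even ((cycE L f).filter (crossing φ)).card := by
  have : (cycE L f).filter (crossing φ) =
      ((Finset.range L).filter (fun i => ¬ (φ (f i) ↔ φ (f (i + 1))))).image
        (fun i => s(f i, f (i + 1))) := by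
    rw [cycE, Finset.filter_image]
    simp only [crossing_iff]
  rw [this, Finset.card_image_of_injOn]
  · rw [seq_parity, h.2.2.1]
  · intro i hi j hj he
    simp only [Finset.coe_filter, Finset.mem_range, Set.mem_ofPred_eq] at hi hj
    exact h.edge_inj hi.1 hj.1 he

/-- Two cycles with different edge sets: the symmetric difference has at least `girth` edges. -/
lemma girth_le_symmDiff {L L' : ℕ} {f f' : ℕ → V} (h : IsCyc G L f) (h' : IsCyc G L' f')
    (hne : cycE L f ≠ cycE L' f') :
    G.girth ≤ (cycE L f \ cycE L' f').card + (cycE L' f' \ cycE L f).card := by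
  classical
  set E := cycE L f
  set E' := cycE L' f'
  set D := (E \ E') ∪ (E' \ E) with hDdef
  have hcard : D.card = (E \ E').card + (E' \ E).card := by
    apply Finset.card_union_of_disjoint
    rw [Finset.disjoint_left]; intro e; simp; tauto
  rw [← hcard]
  have hDG : ∀ e ∈ D, e ∈ G.edgeSet := by
    intro e he
    simp only [hDdef, Finset.mem_union, Finset.mem_sdiff] at he
    rcases he with he | he
    · exact h.cycE_sub e he.1
    · exact h'.cycE_sub e he.1
  have hDne : D.Nonempty := by
    by_contra hcon
    rw [Finset.not_nonempty_iff_eq_empty] at hcon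
    apply hne
    ext e
    have : e ∉ D := by rw [hcon]; simp
    simp only [hDdef, Finset.mem_union, Finset.mem_sdiff] at this
    tauto
  obtain ⟨e, he⟩ := hDne
  induction e using Sym2.ind with
  | _ x y =>
  apply girth_le_of_reach hDG he
  by_contra hr
  set H := fromEdgeSet ((D : Set (Sym2 V)) \ {s(x, y)}) with hH
  set φ : V → Prop := fun z => H.Reachable y z with hφ
  have hcross : D.filter (crossing φ) = {s(x, y)} := by
    ext e
    simp only [Finset.mem_filter, Finset.mem_singleton]
    constructor
    · rintro ⟨heD, a, b, rfl, ha, hb⟩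
      by_contra hne2
      apply hb
      have hab : H.Adj a b := by
        rw [hH, fromEdgeSet_adj]
        exact ⟨⟨heD, hne2⟩, (show G.Adj a b from hDG _ heD).ne⟩
      exact ha.trans hab.reachable
    · rintro rfl
      exact ⟨he, y, x, Sym2.eq_swap, Reachable.refl _, hr⟩
  have p1 := h.parity φ
  have p2 := h'.parity φ
  have c0 : (D.filter (crossing φ)).card =
      ((E \ E').filter (crossing φ)).card + ((E' \ E).filter (crossing φ)).card := by
    rw [hDdef, Finset.filter_union, Finset.card_union_of_disjoint]
    rw [Finset.disjoint_left]; intro e; simp; tauto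
  have c1 : (E.filter (crossing φ)).card =
      ((E \ E').filter (crossing φ)).card + ((E ∩ E').filter (crossing φ)).card := by
    rw [← Finset.card_union_of_disjoint, ← Finset.filter_union]
    · congr 2; ext e; simp; tauto
    · rw [Finset.disjoint_left]; intro e; simp; tauto
  have c2 : (E'.filter (crossing φ)).card =
      ((E' \ E).filter (crossing φ)).card + ((E ∩ E').filter (crossing φ)).card := by
    rw [← Finset.card_union_of_disjoint, ← Finset.filter_union]
    · congr 2; ext e; simp; tauto
    · rw [Finset.disjoint_left]; intro e; simp; tauto
  rw [hcross, Finset.card_singleton] at c0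
  change Even (E.filter (crossing φ)).card at p1
  change Even (E'.filter (crossing φ)).card at p2
  rw [c1] at p1
  rw [c2] at p2
  rw [Nat.even_iff] at p1 p2
  omega

lemma arc_reach {H : SimpleGraph V} {f : ℕ → V} {i j : ℕ} (hij : i ≤ j)
    (h : ∀ l, i ≤ l → l < j → H.Adj (f l) (f (l + 1))) : H.Reachable (f i) (f j) := by
  induction j, hij using Nat.le_induction with
  | base => exact Reachable.refl _
  | succ n hn ih =>
    exact (ih (fun l h1 h2 => h l h1 (by omega))).trans (h n hn (by omega)).reachable

end combi

set_option linter.unusedSectionVars false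
set_option linter.unusedDecidableInType false
set_option linter.unusedFintypeInType false

section combi2
variable {V : Type} [Fintype V] [DecidableEq V] {G : SimpleGraph V}

lemma cyc_length_le {c k L : ℕ} {f f' : ℕ → V} {E : Finset (Sym2 V)}
    (hE : ∀ e, e ∈ E ↔ e ∈ G.edgeSet) (hcard : E.card = c + k)
    (hf : IsCyc G c f) (hf' : IsCyc G L f') (hne : cycE c f ≠ cycE L f') :
    L + G.girth ≤ c + 2 * k := by
  have h1 := girth_le_symmDiff hf hf' hne
  have h2 : (cycE L f' \ cycE c f).card ≤ k := by
    have : cycE L f' \ cycE c f ⊆ E \ cycE c f := by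
      intro e he
      rw [Finset.mem_sdiff] at he ⊢
      exact ⟨(hE e).2 (hf'.cycE_sub e he.1), he.2⟩
    have h3 := Finset.card_le_card this
    rw [Finset.card_sdiff_of_subset (fun e he => (hE e).2 (hf.cycE_sub e he)), hcard, hf.card_cycE] at h3
    omega
  have h4 := Finset.card_sdiff_add_card_inter (cycE L f') (cycE c f)
  have h5 := Finset.card_sdiff_add_card_inter (cycE c f) (cycE L f')
  rw [Finset.inter_comm] at h5
  rw [hf.card_cycE] at h5
  rw [hf'.card_cycE] at h4
  omega

lemma shortcut_reach {c k L : ℕ} {f z : ℕ → V} {E : Finset (Sym2 V)}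
    (hE : ∀ e, e ∈ E ↔ e ∈ G.edgeSet) (hcard : E.card = c + k)
    (hf : IsCyc G c f) (hz : IsCyc G L z) (hlt : L < c) (hk : k < G.girth) :
    ∃ i j, i < j ∧ j < c ∧
      (fromEdgeSet ((E \ cycE c f : Finset (Sym2 V)) : Set (Sym2 V))).Reachable (f i) (f j) := by
  classical
  by_contra hcon
  push Not at hcon
  set H := fromEdgeSet ((E \ cycE c f : Finset (Sym2 V)) : Set (Sym2 V)) with hH
  have huniq : ∀ i < c, ∀ j < c, H.Reachable (f i) (f j) → i = j := by
    intro i hi j hj hr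
    rcases lt_trichotomy i j with h | h | h
    · exact absurd hr (hcon i j h hj)
    · exact h
    · exact absurd hr.symm (hcon j i h hi)
  have hsub : cycE c f ⊆ E := fun e he => (hE e).2 (hf.cycE_sub e he)
  have hoff : (E \ cycE c f).card = k := by
    rw [Finset.card_sdiff_of_subset hsub, hcard, hf.card_cycE]; omega
  -- an edge of `z` on the cycle
  obtain ⟨e1, he1z, he1⟩ : ∃ e ∈ cycE L z, e ∈ cycE c f := by
    by_contra hno
    push Not at hno
    have : cycE L z ⊆ E \ cycE c f := by
      intro e he
      rw [Finset.mem_sdiff]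
      exact ⟨(hE e).2 (hz.cycE_sub e he), hno e he⟩
    have := Finset.card_le_card this
    rw [hoff, hz.card_cycE] at this
    have := hz.girth_le
    omega
  obtain ⟨e0, he0, he0z⟩ : ∃ e ∈ cycE c f, e ∉ cycE L z := by
    by_contra hno
    push Not at hno
    have := Finset.card_le_card (show cycE c f ⊆ cycE L z from hno)
    rw [hf.card_cycE, hz.card_cycE] at this
    omega
  obtain ⟨i1, hi1, rfl⟩ := mem_cycE.1 he1
  obtain ⟨i0, hi0, rfl⟩ := mem_cycE.1 he0
  have hne : i0 ≠ i1 := by rintro rfl; exact he0z he1z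
  set lo := min i0 i1 with hlo
  set hi := max i0 i1 with hhi
  set φ : V → Prop := fun w => ∃ j, lo < j ∧ j ≤ hi ∧ H.Reachable w (f j) with hφ
  have hφf : ∀ i < c, (φ (f i) ↔ lo < i ∧ i ≤ hi) := by
    intro i hic
    constructor
    · rintro ⟨j, hj1, hj2, hr⟩
      have := huniq i hic j (by omega) hr
      omega
    · rintro ⟨h1, h2⟩
      exact ⟨i, h1, h2, Reachable.refl _⟩
  have hφs : ∀ i < c, (φ (f (i + 1)) ↔ lo ≤ i ∧ i < hi) := by
    intro i hic
    by_cases h : i + 1 < c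
    · rw [hφf _ h]; omega
    · rw [show i + 1 = c by omega, hf.2.2.1, hφf 0 (by omega)]; omega
  have hcr : (cycE L z).filter (crossing φ) = {s(f i1, f (i1 + 1))} := by
    ext e
    simp only [Finset.mem_filter, Finset.mem_singleton]
    constructor
    · rintro ⟨hez, hec⟩
      by_cases hef : e ∈ cycE c f
      · obtain ⟨l, hl, rfl⟩ := mem_cycE.1 hef
        rw [crossing_iff, hφf l hl, hφs l hl] at hec
        have : l = i0 ∨ l = i1 := by omega
        rcases this with rfl | rfl
        · exact absurd hez he0z
        · rfl
      · exfalso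
        obtain ⟨a, b, rfl, ⟨j, hj1, hj2, hr⟩, hb⟩ := hec
        apply hb
        have hab : H.Adj b a := by
          rw [hH, fromEdgeSet_adj, Sym2.eq_swap]
          have hG : G.Adj a b := hz.cycE_sub _ hez
          refine ⟨?_, hG.ne'⟩
          rw [Finset.mem_coe, Finset.mem_sdiff]
          exact ⟨(hE _).2 hG, hef⟩
        exact ⟨j, hj1, hj2, hab.reachable.trans hr⟩
    · rintro rfl
      refine ⟨he1z, ?_⟩
      rw [crossing_iff, hφf i1 hi1, hφs i1 hi1]
      omega
  have := hz.parity φ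
  rw [hcr] at this
  simp at this

lemma shortcut {c k L : ℕ} {f z : ℕ → V} {E : Finset (Sym2 V)}
    (hE : ∀ e, e ∈ E ↔ e ∈ G.edgeSet) (hcard : E.card = c + k)
    (hf : IsCyc G c f) (hz : IsCyc G L z) (hlt : L < c) (hk : k < G.girth) :
    ∃ i j, i < j ∧ j < c ∧ G.dist (f i) (f j) ≤ k ∧ G.girth ≤ k + (j - i) ∧
      G.girth ≤ k + (c - (j - i)) ∧ G.Reachable (f i) (f j) := by
  classical
  obtain ⟨i, j, hij, hjc, hr⟩ := shortcut_reach hE hcard hf hz hlt hk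
  have hsub : cycE c f ⊆ E := fun e he => (hE e).2 (hf.cycE_sub e he)
  set O := E \ cycE c f with hO
  have hoff : O.card = k := by
    rw [Finset.card_sdiff_of_subset hsub, hcard, hf.card_cycE]; omega
  have hOE : ∀ e ∈ O, e ∈ G.edgeSet := fun e he => (hE e).1 (Finset.mem_sdiff.1 he).1
  set H := fromEdgeSet (O : Set (Sym2 V)) with hH
  have hle : H ≤ G := by
    intro a b hab
    rw [hH, fromEdgeSet_adj] at hab
    exact hOE _ hab.1
  -- generic arc argument
  have key : ∀ A : Finset ℕ, (∀ l ∈ A, l < c) → ∀ l0 ∈ A,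
      (∀ H' : SimpleGraph V, (∀ l ∈ A, l ≠ l0 → H'.Adj (f l) (f (l + 1))) →
        H'.Reachable (f i) (f j) → H'.Reachable (f (l0 + 1)) (f l0)) →
      G.girth ≤ k + A.card := by
    intro A hA l0 hl0 hreach
    set D := O ∪ A.image (fun l => s(f l, f (l + 1))) with hD
    have hDG : ∀ e ∈ D, e ∈ G.edgeSet := by
      intro e he
      rw [hD, Finset.mem_union, Finset.mem_image] at he
      rcases he with he | ⟨l, hl, rfl⟩
      · exact hOE e he
      · exact hf.2.1 l (hA l hl)
    have hmem : s(f l0, f (l0 + 1)) ∈ D := by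
      rw [hD, Finset.mem_union]
      exact Or.inr (Finset.mem_image_of_mem _ hl0)
    have h1 := girth_le_of_reach hDG hmem (hreach _ ?_ ?_)
    · refine h1.trans ((Finset.card_union_le _ _).trans ?_)
      have := Finset.card_image_le (s := A) (f := fun l => s(f l, f (l + 1)))
      omega
    · intro l hl hne
      rw [fromEdgeSet_adj]
      refine ⟨⟨?_, ?_⟩, (hf.2.1 l (hA l hl)).ne⟩
      · rw [Finset.mem_coe, hD, Finset.mem_union]
        exact Or.inr (Finset.mem_image_of_mem _ hl)
      · intro heq
        exact hne (hf.edge_inj (hA l hl) (hA l0 hl0) heq)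
    · apply hr.mono
      intro a b hab
      rw [hH, fromEdgeSet_adj] at hab
      rw [fromEdgeSet_adj]
      refine ⟨⟨?_, ?_⟩, hab.2⟩
      · rw [Finset.mem_coe, hD, Finset.mem_union]
        exact Or.inl hab.1
      · intro heq
        rw [Set.mem_singleton_iff] at heq
        have h2 := hab.1
        rw [heq, Finset.mem_coe, hO, Finset.mem_sdiff] at h2
        exact h2.2 (mem_cycE.2 ⟨l0, hA l0 hl0, rfl⟩)
  refine ⟨i, j, hij, hjc, ?_, ?_, ?_, hr.mono hle⟩
  · obtain ⟨p, hp⟩ := hr.exists_isPath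
    have h1 := length_le_of_fromEdgeSet hp
    have h2 := G.dist_le (p.mapLe hle)
    simp at h2
    omega
  · have := key (Finset.Ico i j) (by simp; omega) i (by simp; omega) ?_
    · simpa using this
    · intro H' h1 h2
      have h3 : H'.Reachable (f (i + 1)) (f j) :=
        arc_reach (by omega) (fun l hl1 hl2 => h1 l (by simp; omega) (by omega))
      exact h3.trans h2.symm
  · have := key (Finset.range c \ Finset.Ico i j) (by simp; omega) j (by simp; omega) ?_
    · rw [Finset.card_sdiff_of_subset (by intro l; simp; omega)] at this
      simpa using this
    · intro H' h1 h2
      have h3 : H'.Reachable (f (j + 1)) (f c) :=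
        arc_reach (by omega) (fun l hl1 hl2 => h1 l (by simp; omega) (by omega))
      have h4 : H'.Reachable (f 0) (f i) :=
        arc_reach (by omega) (fun l hl1 hl2 => h1 l (by simp; omega) (by omega))
      rw [hf.2.2.1] at h3
      exact (h3.trans h4).trans h2

/-- A girth cycle is isometric. -/
lemma girth_cyc_dist {f : ℕ → V} (hG : G.Connected) (hf : IsCyc G G.girth f) {i j : ℕ}
    (hij : i < j) (hj : j < G.girth) :
    min (j - i) (G.girth - (j - i)) ≤ G.dist (f i) (f j) := by
  classical
  by_contra hcon
  push Not at hcon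
  obtain ⟨p, hp, hpl⟩ := hG.exists_path_of_dist (f i) (f j)
  set P := p.edges.toFinset with hP
  have hPc : P.card ≤ G.dist (f i) (f j) := by
    rw [← hpl, ← Walk.length_edges]; exact List.toFinset_card_le _
  set A := (Finset.Ico i j).image (fun l => s(f l, f (l + 1))) with hA
  have hAc : A.card = j - i := by
    rw [hA, Finset.card_image_of_injOn]
    · simp
    · intro a ha b hb hab
      simp only [Finset.coe_Ico, Set.mem_Ico] at ha hb
      exact hf.edge_inj (by omega) (by omega) hab
  obtain ⟨e, heA, heP⟩ : ∃ e ∈ A, e ∉ P := by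
    by_contra hno
    push Not at hno
    have := Finset.card_le_card (show A ⊆ P from hno)
    omega
  rw [hA, Finset.mem_image] at heA
  obtain ⟨l0, hl0, rfl⟩ := heA
  rw [Finset.mem_Ico] at hl0
  have hDG : ∀ e ∈ P ∪ A, e ∈ G.edgeSet := by
    intro e he
    rw [Finset.mem_union, hA, Finset.mem_image] at he
    rcases he with he | ⟨l, hl, rfl⟩
    · rw [hP, List.mem_toFinset] at he
      exact p.edges_subset_edgeSet he
    · rw [Finset.mem_Ico] at hl
      exact hf.2.1 l (by omega)
  have hmem : s(f l0, f (l0 + 1)) ∈ P ∪ A := by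
    rw [Finset.mem_union]
    exact Or.inr (Finset.mem_image_of_mem _ (by simp; omega))
  have hadj : ∀ l, i ≤ l → l < j → l ≠ l0 →
      (fromEdgeSet (((P ∪ A : Finset (Sym2 V)) : Set (Sym2 V)) \ {s(f l0, f (l0 + 1))})).Adj
        (f l) (f (l + 1)) := by
    intro l h1 h2 hne
    rw [fromEdgeSet_adj]
    refine ⟨⟨?_, ?_⟩, (hf.2.1 l (by omega)).ne⟩
    · rw [Finset.mem_coe, Finset.mem_union]
      exact Or.inr (Finset.mem_image_of_mem _ (by simp; omega))
    · intro heq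
      exact hne (hf.edge_inj (by omega) (by omega) heq)
  have hreach : (fromEdgeSet (((P ∪ A : Finset (Sym2 V)) : Set (Sym2 V)) \
      {s(f l0, f (l0 + 1))})).Reachable (f i) (f j) := by
    refine ⟨p.transfer _ ?_⟩
    intro e he
    rw [edgeSet_fromEdgeSet]
    refine ⟨⟨?_, ?_⟩, ?_⟩
    · rw [Finset.mem_coe, Finset.mem_union, hP, List.mem_toFinset]; exact Or.inl he
    · rintro rfl
      exact heP (List.mem_toFinset.2 he)
    · exact G.not_isDiag_of_mem_edgeSet (p.edges_subset_edgeSet he)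
  have h1 := girth_le_of_reach hDG hmem
    (((arc_reach (f := f) (i := l0 + 1) (j := j) (by omega)
      (fun l h1 h2 => hadj l (by omega) h2 (by omega))).trans hreach.symm).trans
      (arc_reach (f := f) (i := i) (j := l0) (by omega)
      (fun l h1 h2 => hadj l h1 (by omega) (by omega))))
  have h2 := Finset.card_union_le P A
  omega

end combi2

set_option linter.unusedSectionVars false
set_option linter.unusedDecidableInType false
set_option linter.unusedFintypeInType false

section metric
variable {V : Type} [Fintype V] [DecidableEq V] {G : SimpleGraph V}

lemma mgDist_eq (p q : MGPoint G) : mgDist G p q =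
    min (min (if p.1.1 = q.1.1 ∧ p.1.2.1 = q.1.2.1 then |p.1.2.2 - q.1.2.2|
          else (Fintype.card V : ℝ) + 1)
         (if p.1.1 = q.1.2.1 ∧ p.1.2.1 = q.1.1 then |p.1.2.2 - (1 - q.1.2.2)|
          else (Fintype.card V : ℝ) + 1))
    (min (p.1.2.2 + mgVDist G p.1.1 q) ((1 - p.1.2.2) + mgVDist G p.1.2.1 q)) := by
  unfold mgDist mgDistAux mgVDist
  simp only [← min_add_add_left, add_assoc]

lemma mgDist_le_left (p q : MGPoint G) : mgDist G p q ≤ p.1.2.2 + mgVDist G p.1.1 q := by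
  rw [mgDist_eq]; exact (min_le_right _ _).trans (min_le_left _ _)

lemma mgDist_le_right (p q : MGPoint G) : mgDist G p q ≤ (1 - p.1.2.2) + mgVDist G p.1.2.1 q := by
  rw [mgDist_eq]; exact (min_le_right _ _).trans (min_le_right _ _)

lemma mgDist_le_same (p q : MGPoint G) (h1 : p.1.1 = q.1.1) (h2 : p.1.2.1 = q.1.2.1) :
    mgDist G p q ≤ |p.1.2.2 - q.1.2.2| := by
  rw [mgDist_eq, if_pos ⟨h1, h2⟩]; exact (min_le_left _ _).trans (min_le_left _ _)

lemma mgDist_le_flip (p q : MGPoint G) (h1 : p.1.1 = q.1.2.1) (h2 : p.1.2.1 = q.1.1) :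
    mgDist G p q ≤ |p.1.2.2 - (1 - q.1.2.2)| := by
  rw [mgDist_eq, if_pos (c := p.1.1 = q.1.2.1 ∧ p.1.2.1 = q.1.1) ⟨h1, h2⟩]
  exact (min_le_left _ _).trans (min_le_right _ _)

lemma mgDist_comm' (p q : MGPoint G) : mgDist G p q = mgDist G q p := by
  unfold mgDist mgDistAux
  have e1 : (p.1.1 = q.1.1 ∧ p.1.2.1 = q.1.2.1) ↔ (q.1.1 = p.1.1 ∧ q.1.2.1 = p.1.2.1) :=
    ⟨fun h => ⟨h.1.symm, h.2.symm⟩, fun h => ⟨h.1.symm, h.2.symm⟩⟩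
  have e2 : (p.1.1 = q.1.2.1 ∧ p.1.2.1 = q.1.1) ↔ (q.1.1 = p.1.2.1 ∧ q.1.2.1 = p.1.1) :=
    ⟨fun h => ⟨h.2.symm, h.1.symm⟩, fun h => ⟨h.2.symm, h.1.symm⟩⟩
  congr 1
  · congr 1
    · simp only [e1, abs_sub_comm]
    · simp only [e2]
      rw [show p.1.2.2 - (1 - q.1.2.2) = q.1.2.2 - (1 - p.1.2.2) by ring]
  · rw [min_min_min_comm]
    simp only [G.dist_comm (u := p.1.1), G.dist_comm (u := p.1.2.1)]
    congr 1 <;> congr 1 <;> ring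

lemma t_nonneg (p : MGPoint G) : 0 ≤ p.1.2.2 := p.2.2.1
lemma t_le_one (p : MGPoint G) : p.1.2.2 ≤ 1 := p.2.2.2

lemma mgVDist_nonneg (v : V) (q : MGPoint G) : 0 ≤ mgVDist G v q := by
  have := t_nonneg q
  have := t_le_one q
  unfold mgVDist
  apply le_min
  · positivity
  · have : (0:ℝ) ≤ G.dist v q.1.2.1 := by positivity
    linarith

lemma dist_card (hG : G.Connected) (u v : V) : (G.dist u v : ℝ) + 1 ≤ Fintype.card V := by
  obtain ⟨p, hp, hl⟩ := hG.exists_path_of_dist u v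
  have := hp.length_lt
  rw [hl] at this
  exact_mod_cast this

lemma mgVDist_card (hG : G.Connected) (v : V) (q : MGPoint G) :
    mgVDist G v q ≤ Fintype.card V - 1/2 := by
  have h1 := dist_card hG v q.1.1
  have h2 := dist_card hG v q.1.2.1
  unfold mgVDist
  rcases le_total q.1.2.2 (1/2) with h | h
  · exact (min_le_left _ _).trans (by linarith)
  · exact (min_le_right _ _).trans (by linarith)

lemma mgDist_cases (hG : G.Connected) (p q : MGPoint G) :
    (mgDist G p q = |p.1.2.2 - q.1.2.2| ∧ p.1.1 = q.1.1 ∧ p.1.2.1 = q.1.2.1) ∨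
    (mgDist G p q = |p.1.2.2 - (1 - q.1.2.2)| ∧ p.1.1 = q.1.2.1 ∧ p.1.2.1 = q.1.1) ∨
    mgDist G p q = p.1.2.2 + mgVDist G p.1.1 q ∨
    mgDist G p q = (1 - p.1.2.2) + mgVDist G p.1.2.1 q := by
  have hb : mgDist G p q ≤ Fintype.card V := by
    have h1 := mgDist_le_left p q
    have h2 := mgDist_le_right p q
    have h3 := mgVDist_card hG p.1.1 q
    have h4 := mgVDist_card hG p.1.2.1 q
    linarith
  have h := mgDist_eq p q
  rcases min_choice (min (if p.1.1 = q.1.1 ∧ p.1.2.1 = q.1.2.1 then |p.1.2.2 - q.1.2.2|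
          else (Fintype.card V : ℝ) + 1)
         (if p.1.1 = q.1.2.1 ∧ p.1.2.1 = q.1.1 then |p.1.2.2 - (1 - q.1.2.2)|
          else (Fintype.card V : ℝ) + 1))
    (min (p.1.2.2 + mgVDist G p.1.1 q) ((1 - p.1.2.2) + mgVDist G p.1.2.1 q)) with h1 | h1
  · rw [h1] at h
    rcases min_choice (if p.1.1 = q.1.1 ∧ p.1.2.1 = q.1.2.1 then |p.1.2.2 - q.1.2.2|
          else (Fintype.card V : ℝ) + 1)
         (if p.1.1 = q.1.2.1 ∧ p.1.2.1 = q.1.1 then |p.1.2.2 - (1 - q.1.2.2)|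
          else (Fintype.card V : ℝ) + 1) with h2 | h2
    · rw [h2] at h
      split_ifs at h with hc
      · exact Or.inl ⟨h, hc⟩
      · linarith
    · rw [h2] at h
      split_ifs at h with hc
      · exact Or.inr (Or.inl ⟨h, hc⟩)
      · linarith
  · rw [h1] at h
    rcases min_choice (p.1.2.2 + mgVDist G p.1.1 q) ((1 - p.1.2.2) + mgVDist G p.1.2.1 q)
      with h2 | h2
    · rw [h2] at h; exact Or.inr (Or.inr (Or.inl h))
    · rw [h2] at h; exact Or.inr (Or.inr (Or.inr h))

lemma mgVDist_cases (v : V) (q : MGPoint G) :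
    mgVDist G v q = (G.dist v q.1.1 : ℝ) + q.1.2.2 ∨
    mgVDist G v q = (G.dist v q.1.2.1 : ℝ) + (1 - q.1.2.2) := min_choice _ _

lemma mgVDist_le_left (v : V) (q : MGPoint G) :
    mgVDist G v q ≤ (G.dist v q.1.1 : ℝ) + q.1.2.2 := min_le_left _ _

lemma mgVDist_le_right (v : V) (q : MGPoint G) :
    mgVDist G v q ≤ (G.dist v q.1.2.1 : ℝ) + (1 - q.1.2.2) := min_le_right _ _

lemma dist_tri (hG : G.Connected) (u v w : V) :
    (G.dist u w : ℝ) ≤ G.dist u v + G.dist v w := by exact_mod_cast hG.dist_triangle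

lemma mgVDist_tri (hG : G.Connected) (u v : V) (q : MGPoint G) :
    mgVDist G u q ≤ G.dist u v + mgVDist G v q := by
  rcases mgVDist_cases v q with h | h
  · have := mgVDist_le_left u q; have := dist_tri hG u v q.1.1; linarith
  · have := mgVDist_le_right u q; have := dist_tri hG u v q.1.2.1; linarith

lemma adj_dist (p : MGPoint G) : (G.dist p.1.1 p.1.2.1 : ℝ) = 1 := by
  have : G.dist p.1.1 p.1.2.1 = 1 := dist_eq_one_iff_adj.2 p.2.1
  exact_mod_cast this

lemma dist_le_mgVDist (hG : G.Connected) (u v : V) (q : MGPoint G) :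
    (G.dist u v : ℝ) ≤ mgVDist G u q + mgVDist G v q := by
  have a := t_nonneg q
  have b := t_le_one q
  have e := adj_dist q
  have t1 := dist_tri hG u q.1.1 v
  have t2 := dist_tri hG u q.1.2.1 v
  have t3 := dist_tri hG q.1.1 q.1.2.1 v
  have t4 := dist_tri hG q.1.2.1 q.1.1 v
  rw [G.dist_comm (u := q.1.2.1) (v := q.1.1)] at t4
  have c1 := G.dist_comm (u := v) (v := q.1.1)
  have c2 := G.dist_comm (u := v) (v := q.1.2.1)
  rcases mgVDist_cases u q with h | h <;> rcases mgVDist_cases v q with h' | h' <;>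
    simp only [c1, c2] at h' <;> linarith

/-- The distance to a vertex is Lipschitz. -/
lemma mgVDist_lip (hG : G.Connected) (v : V) (p q : MGPoint G) :
    mgVDist G v p ≤ mgVDist G v q + mgDist G p q := by
  have a1 := mgVDist_le_left v p
  have a2 := mgVDist_le_right v p
  rcases mgDist_cases hG p q with ⟨h, h1, h2⟩ | ⟨h, h1, h2⟩ | h | h
  · have b1 := le_abs_self (p.1.2.2 - q.1.2.2)
    have b2 := neg_abs_le (p.1.2.2 - q.1.2.2)
    rw [h1] at a1; rw [h2] at a2
    rcases mgVDist_cases v q with h' | h' <;> linarith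
  · have b1 := le_abs_self (p.1.2.2 - (1 - q.1.2.2))
    have b2 := neg_abs_le (p.1.2.2 - (1 - q.1.2.2))
    rw [h1] at a1; rw [h2] at a2
    rcases mgVDist_cases v q with h' | h' <;> linarith
  · have := dist_le_mgVDist hG v p.1.1 q; linarith
  · have := dist_le_mgVDist hG v p.1.2.1 q; linarith

lemma mgDist_self' (p : MGPoint G) : mgDist G p p = 0 := by
  apply le_antisymm
  · have := mgDist_le_same p p rfl rfl; simpa using this
  · have h1 := t_nonneg p
    have h2 := t_le_one p
    have h3 := mgVDist_nonneg p.1.1 p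
    have h4 := mgVDist_nonneg p.1.2.1 p
    rw [mgDist_eq]
    refine le_min (le_min ?_ ?_) (le_min (by linarith) (by linarith))
    · split_ifs <;> positivity
    · split_ifs <;> positivity

lemma mgDist_tri (hG : G.Connected) (p q r : MGPoint G) :
    mgDist G p r ≤ mgDist G p q + mgDist G q r := by
  have a1 := mgDist_le_left p r
  have a2 := mgDist_le_right p r
  have lip : ∀ v, mgVDist G v r ≤ mgVDist G v q + mgDist G q r := by
    intro v; rw [mgDist_comm' q r]; exact mgVDist_lip hG v r q
  have main2 : (mgDist G r q = r.1.2.2 + mgVDist G r.1.1 q ∨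
      mgDist G r q = (1 - r.1.2.2) + mgVDist G r.1.2.1 q) →
      mgDist G p r ≤ mgDist G p q + mgDist G q r := by
    intro h
    rw [mgDist_comm' q r, mgDist_comm' p r]
    have b1 := mgDist_le_left r p
    have b2 := mgDist_le_right r p
    rcases h with h | h
    · have := mgVDist_lip hG r.1.1 p q; linarith
    · have := mgVDist_lip hG r.1.2.1 p q; linarith
  rcases mgDist_cases hG p q with ⟨h, h1, h2⟩ | ⟨h, h1, h2⟩ | h | h
  · rcases mgDist_cases hG r q with ⟨h', h1', h2'⟩ | ⟨h', h1', h2'⟩ | h' | h'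
    · have := mgDist_le_same p r (h1.trans h1'.symm) (h2.trans h2'.symm)
      rw [h, mgDist_comm' q r, h', abs_sub_comm r.1.2.2]
      exact this.trans (abs_sub_le _ _ _)
    · have := mgDist_le_flip p r (h1.trans h2'.symm) (h2.trans h1'.symm)
      rw [h, mgDist_comm' q r, h']
      rw [show r.1.2.2 - (1 - q.1.2.2) = q.1.2.2 - (1 - r.1.2.2) by ring]
      exact this.trans (abs_sub_le _ _ _)
    · exact main2 (Or.inl h')
    · exact main2 (Or.inr h')
  · rcases mgDist_cases hG r q with ⟨h', h1', h2'⟩ | ⟨h', h1', h2'⟩ | h' | h'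
    · have := mgDist_le_flip p r (h1.trans h2'.symm) (h2.trans h1'.symm)
      rw [h, mgDist_comm' q r, h']
      rw [show r.1.2.2 - q.1.2.2 = (1 - q.1.2.2) - (1 - r.1.2.2) by ring]
      exact this.trans (abs_sub_le _ _ _)
    · have := mgDist_le_same p r (h1.trans h1'.symm) (h2.trans h2'.symm)
      rw [h, mgDist_comm' q r, h', abs_sub_comm r.1.2.2]
      exact this.trans (abs_sub_le _ _ _)
    · exact main2 (Or.inl h')
    · exact main2 (Or.inr h')
  · have := lip p.1.1; linarith
  · have := lip p.1.2.1; linarith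

noncomputable instance mgPM [hG : Fact G.Connected] : PseudoMetricSpace (MGPoint G) where
  dist p q := mgDist G p q
  dist_self := mgDist_self'
  dist_comm := mgDist_comm'
  dist_triangle := mgDist_tri hG.out

lemma mg_dist_def [Fact G.Connected] (p q : MGPoint G) : dist p q = mgDist G p q := rfl

variable [hG : Fact G.Connected]

lemma vd_lip (v : V) (p q : MGPoint G) : mgVDist G v p ≤ mgVDist G v q + dist p q :=
  mgVDist_lip hG.out v p q

lemma vd_cont (v : V) : Continuous (fun q : MGPoint G => mgVDist G v q) := by
  apply LipschitzWith.continuous (K := 1)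
  apply LipschitzWith.of_dist_le_mul
  intro p q
  rw [Real.dist_eq, abs_sub_le_iff]
  have h1 := vd_lip v p q
  have h2 := vd_lip v q p
  rw [dist_comm q p] at h2
  constructor <;> simp <;> linarith

/-- The path through a vertex. -/
lemma dist_le_vd (v : V) (p q : MGPoint G) : dist p q ≤ mgVDist G v p + mgVDist G v q := by
  rw [mg_dist_def]
  rcases mgVDist_cases v p with h | h
  · have := mgDist_le_left p q
    have t := mgVDist_tri hG.out p.1.1 v q
    rw [G.dist_comm] at t
    linarith
  · have := mgDist_le_right p q
    have t := mgVDist_tri hG.out p.1.2.1 v q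
    rw [G.dist_comm] at t
    linarith

/-- Distance between points located at vertices. -/
lemma dist_at {u v : V} {p q : MGPoint G} (hp : mgVDist G u p = 0) (hq : mgVDist G v q = 0) :
    dist p q = G.dist u v := by
  have h1 := dist_le_vd u p q
  have h2 := mgVDist_tri hG.out u v q
  have h3 := dist_le_mgVDist hG.out u v q
  have h4 := vd_lip u q p
  rw [dist_comm q p] at h4
  linarith

lemma vd_at {u v : V} {q : MGPoint G} (hq : mgVDist G v q = 0) :
    mgVDist G u q = G.dist u v := by
  have h2 := mgVDist_tri hG.out u v q
  have h3 := dist_le_mgVDist hG.out u v q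
  linarith

/-- Points at integer distance from a vertex are vertices. -/
lemma level_vertex {v : V} {n : ℕ} {q : MGPoint G} (h : mgVDist G v q = n) :
    ∃ w, mgVDist G w q = 0 := by
  have a := t_nonneg q
  have b := t_le_one q
  have l0 : q.1.2.2 = 0 → mgVDist G q.1.1 q = 0 := by
    intro h0
    have h1 := mgVDist_le_left q.1.1 q
    simp [h0] at h1
    exact le_antisymm h1 (mgVDist_nonneg _ _)
  have l1 : q.1.2.2 = 1 → mgVDist G q.1.2.1 q = 0 := by
    intro h0
    have h1 := mgVDist_le_right q.1.2.1 q
    simp [h0] at h1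
    exact le_antisymm h1 (mgVDist_nonneg _ _)
  have key : ∀ d : ℕ, (n : ℝ) - d = q.1.2.2 → ∃ w, mgVDist G w q = 0 := by
    intro d hd
    have e1 : ((n : ℤ) - (d : ℤ) : ℝ) = q.1.2.2 := by exact_mod_cast hd
    have h1 : (0 : ℤ) ≤ (n : ℤ) - d := by
      have : (0:ℝ) ≤ ((n : ℤ) - (d : ℤ) : ℝ) := by rw [e1]; exact a
      exact_mod_cast this
    have h2 : (n : ℤ) - d ≤ 1 := by
      have : ((n : ℤ) - (d : ℤ) : ℝ) ≤ 1 := by rw [e1]; exact b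
      exact_mod_cast this
    have : (n : ℤ) = d ∨ (n : ℤ) = d + 1 := by omega
    rcases this with h | h
    · refine ⟨_, l0 ?_⟩
      have : n = d := by omega
      rw [← hd, this]; simp
    · refine ⟨_, l1 ?_⟩
      have : n = d + 1 := by omega
      rw [← hd, this]; push_cast; ring
  rcases mgVDist_cases v q with h' | h'
  · exact key (G.dist v q.1.1) (by linarith)
  · rw [h] at h'
    have e : q.1.2.2 = (G.dist v q.1.2.1 : ℝ) + 1 - n := by linarith
    have e1 : ((G.dist v q.1.2.1 : ℤ) + 1 - (n : ℤ) : ℝ) = q.1.2.2 := by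
      rw [e]; push_cast; ring
    have h1 : (0 : ℤ) ≤ (G.dist v q.1.2.1 : ℤ) + 1 - n := by
      have : (0:ℝ) ≤ ((G.dist v q.1.2.1 : ℤ) + 1 - (n : ℤ) : ℝ) := by rw [e1]; exact a
      exact_mod_cast this
    have h2 : (G.dist v q.1.2.1 : ℤ) + 1 - n ≤ 1 := by
      have : ((G.dist v q.1.2.1 : ℤ) + 1 - (n : ℤ) : ℝ) ≤ 1 := by rw [e1]; exact b
      exact_mod_cast this
    have : n = G.dist v q.1.2.1 ∨ n = G.dist v q.1.2.1 + 1 := by omega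
    rcases this with h | h
    · refine ⟨_, l1 ?_⟩
      rw [e, h]; ring
    · refine ⟨_, l0 ?_⟩
      rw [e, h]; push_cast; ring

/-- The midpoint of the edge of a point. -/
noncomputable def mgMid (q : MGPoint G) : MGPoint G :=
  ⟨(q.1.1, q.1.2.1, 1/2), q.2.1, by constructor <;> norm_num⟩

lemma mid_self (q : MGPoint G) : dist (mgMid q) q ≤ 1/2 := by
  have := mgDist_le_same (mgMid q) q rfl rfl
  rw [mg_dist_def]
  refine this.trans ?_
  have a := t_nonneg q
  have b := t_le_one q
  rw [abs_le]
  simp only [mgMid]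
  constructor <;> linarith

lemma mid_level {q z : MGPoint G} (h : dist (mgMid q) z = 1/2) :
    mgVDist G q.1.1 z = 0 ∨ mgVDist G q.1.2.1 z = 0 := by
  have n1 := mgVDist_nonneg q.1.1 z
  have n2 := mgVDist_nonneg q.1.2.1 z
  have a := t_nonneg z
  have b := t_le_one z
  rw [mg_dist_def] at h
  rcases mgDist_cases hG.out (mgMid q) z with ⟨h', h1, h2⟩ | ⟨h', h1, h2⟩ | h' | h'
  · rw [h] at h'
    simp only [mgMid] at h' h1 h2
    have c1 := mgVDist_le_left q.1.1 z
    have c2 := mgVDist_le_right q.1.2.1 z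
    simp only [h1, h2, SimpleGraph.dist_self, Nat.cast_zero] at c1 c2
    rw [← h1] at c1
    rw [← h2] at c2
    rcases le_total (1/2 - z.1.2.2) 0 with hs | hs
    · rw [abs_of_nonpos hs] at h'
      right; linarith
    · rw [abs_of_nonneg hs] at h'
      left; linarith
  · rw [h] at h'
    simp only [mgMid] at h' h1 h2
    have c1 := mgVDist_le_right q.1.1 z
    have c2 := mgVDist_le_left q.1.2.1 z
    simp only [h1, h2, SimpleGraph.dist_self, Nat.cast_zero] at c1 c2
    rw [← h1] at c1
    rw [← h2] at c2
    rcases le_total (1/2 - (1 - z.1.2.2)) 0 with hs | hs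
    · rw [abs_of_nonpos hs] at h'
      right; linarith
    · rw [abs_of_nonneg hs] at h'
      left; linarith
  · simp only [mgMid] at h'; left; simp only [mgMid] at h; linarith
  · simp only [mgMid] at h'; right; simp only [mgMid] at h; linarith

/-- A connected set containing a point of an edge and a far away point contains an endpoint
of that edge. -/
lemma cross_edge {K : Set (MGPoint G)} (hK : IsPreconnected K) {q z : MGPoint G} (hq : q ∈ K)
    (hz : z ∈ K) (hd : 1 ≤ dist q z) :
    ∃ x ∈ K, mgVDist G q.1.1 x = 0 ∨ mgVDist G q.1.2.1 x = 0 := by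
  have h1 := mid_self q
  have h2 : 1/2 ≤ dist (mgMid q) z := by
    have := dist_triangle q (mgMid q) z
    rw [dist_comm q (mgMid q)] at this
    linarith
  have hc : ContinuousOn (fun x => dist (mgMid q) x) K := by fun_prop
  obtain ⟨x, hx, hxe⟩ := hK.intermediate_value hq hz hc ⟨h1, h2⟩
  exact ⟨x, hx, mid_level hxe⟩

/-- Vertices in a connected set are connected through vertices of that set. -/
lemma conn_reach {K : Set (MGPoint G)} (hK : IsPreconnected K) {u v : V} {p q : MGPoint G}
    (hp : p ∈ K) (hq : q ∈ K) (hu : mgVDist G u p = 0) (hv : mgVDist G v q = 0) :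
    ∃ w : G.Walk u v, w.IsPath ∧ ∀ x ∈ w.support, ∃ z ∈ K, mgVDist G x z = 0 := by
  classical
  -- the graph of edges between visited vertices
  set S : V → Prop := fun x => ∃ z ∈ K, mgVDist G x z = 0 with hS
  set H : SimpleGraph V := { Adj := fun a b => G.Adj a b ∧ S a ∧ S b
                             symm := ⟨fun a b h => ⟨h.1.symm, h.2.2, h.2.1⟩⟩
                             loopless := ⟨fun a h => G.loopless.irrefl a h.1⟩ } with hH
  have hle : H ≤ G := fun a b h => h.1
  have hreach : H.Reachable u v := by
    by_contra hno
    set A : Finset V := Finset.univ.filter (fun x => H.Reachable u x) with hA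
    have huA : u ∈ A := by simp [hA]
    have hAS : ∀ x ∈ A, S x := by
      intro x hx
      simp only [hA, Finset.mem_filter, Finset.mem_univ, true_and] at hx
      by_cases hxu : u = x
      · exact hxu ▸ ⟨p, hp, hu⟩
      · obtain ⟨w⟩ := hx.symm
        cases w with
        | nil => exact absurd rfl hxu
        | cons h _ => exact h.2.1
    have hF : Continuous (fun z : MGPoint G => A.inf' ⟨u, huA⟩ (fun x => mgVDist G x z)) :=
      Continuous.finset_inf'_apply _ (fun x _ => vd_cont x)
    have h0 : A.inf' ⟨u, huA⟩ (fun x => mgVDist G x p) ≤ 1 :=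
      (Finset.inf'_le _ huA).trans (by rw [hu]; norm_num)
    have h1 : (1:ℝ) ≤ A.inf' ⟨u, huA⟩ (fun x => mgVDist G x q) := by
      apply Finset.le_inf'
      intro x hx
      rw [vd_at hv]
      have : x ≠ v := by
        rintro rfl
        simp only [hA, Finset.mem_filter, Finset.mem_univ, true_and] at hx
        exact hno hx
      have := hG.out.pos_dist_of_ne this
      exact_mod_cast this
    obtain ⟨z, hz, hze⟩ := hK.intermediate_value hp hq hF.continuousOn ⟨h0, h1⟩
    obtain ⟨x, hx, hxe⟩ := Finset.exists_mem_eq_inf' ⟨u, huA⟩ (fun x => mgVDist G x z)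
    simp only at hze
    rw [hxe] at hze
    obtain ⟨w, hw⟩ := level_vertex (n := 1) (by simpa using hze)
    have hxw : G.Adj x w := by
      rw [vd_at hw] at hze
      rw [← dist_eq_one_iff_adj]; exact_mod_cast hze
    have hwA : w ∈ A := by
      have hHa : H.Adj x w := ⟨hxw, hAS x hx, z, hz, hw⟩
      simp only [hA, Finset.mem_filter, Finset.mem_univ, true_and] at hx ⊢
      exact hx.trans hHa.reachable
    have := Finset.inf'_le (fun x => mgVDist G x z) hwA
    rw [hxe, hze, hw] at this
    linarith
  obtain ⟨w, hw⟩ := hreach.exists_isPath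
  refine ⟨w.mapLe hle, by simpa using hw, ?_⟩
  intro x hx
  have hx' : x ∈ w.support := by simpa using hx
  by_cases hxu : x = u
  · exact hxu ▸ ⟨p, hp, hu⟩
  · obtain ⟨w1⟩ : H.Reachable x u := ⟨(w.takeUntil x hx').reverse⟩
    cases w1 with
    | nil => exact absurd rfl hxu
    | cons h _ => exact h.2.1

end metric

set_option linter.unusedSectionVars false
set_option linter.unusedDecidableInType false
set_option linter.unusedFintypeInType false

section upper
variable {V : Type} [Fintype V] [DecidableEq V] {G : SimpleGraph V} [hG : Fact G.Connected]

/-- Geodesic between two parameters. -/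
def Geo (a b : ℝ) (γ : ℝ → MGPoint G) : Prop :=
  ∀ s ∈ Set.Icc a b, ∀ t ∈ Set.Icc a b, dist (γ s) (γ t) = |s - t|

lemma Geo.mono {a b a' b' : ℝ} {γ : ℝ → MGPoint G} (h : Geo a b γ) (ha : a ≤ a') (hb : b' ≤ b) :
    Geo a' b' γ := fun s hs t ht => h s ⟨ha.trans hs.1, hs.2.trans hb⟩ t ⟨ha.trans ht.1, ht.2.trans hb⟩

lemma Geo.rev {a b : ℝ} {γ : ℝ → MGPoint G} (h : Geo a b γ) :
    Geo (-b) (-a) (fun s => γ (-s)) := by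
  intro s hs t ht
  rw [h (-s) ⟨by linarith [hs.2], by linarith [hs.1]⟩ (-t) ⟨by linarith [ht.2], by linarith [ht.1]⟩]
  rw [show -s - -t = -(s - t) by ring, abs_neg]

lemma Geo.cont {a b : ℝ} {γ : ℝ → MGPoint G} (h : Geo a b γ) : ContinuousOn γ (Set.Icc a b) := by
  apply LipschitzOnWith.continuousOn (K := 1)
  apply LipschitzOnWith.of_dist_le_mul
  intro x hx y hy
  rw [h x hx y hy, Real.dist_eq]; simp

lemma closed_zero {K : Set (MGPoint G)} (hK : IsClosed K) {x y : MGPoint G} (hx : x ∈ K)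
    (h : dist y x = 0) : y ∈ K := by
  rw [← hK.closure_eq, Metric.mem_closure_iff]
  intro ε hε
  exact ⟨x, hx, by rw [h]; exact hε⟩

lemma at_zero {u : V} {p q : MGPoint G} (hp : mgVDist G u p = 0) (hq : mgVDist G u q = 0) :
    dist p q = 0 := by rw [dist_at hp hq]; simp

lemma at_uniq {u v : V} {p : MGPoint G} (hp : mgVDist G u p = 0) (hq : mgVDist G v p = 0) :
    u = v := by
  have := dist_le_mgVDist hG.out u v p
  rw [hp, hq] at this
  by_contra hne
  have := hG.out.pos_dist_of_ne hne
  have : (1:ℝ) ≤ G.dist u v := by exact_mod_cast this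
  linarith

lemma vd_dist {u : V} {p q : MGPoint G} (hp : mgVDist G u p = 0) :
    mgVDist G u q = dist p q := by
  have h1 := dist_le_vd u p q
  have h2 := vd_lip u q p
  rw [dist_comm q p] at h2
  linarith

lemma adj_of_at {u v : V} {p q : MGPoint G} (hp : mgVDist G u p = 0) (hq : mgVDist G v q = 0)
    (h : dist p q = 1) : G.Adj u v := by
  rw [dist_at hp hq] at h
  rw [← dist_eq_one_iff_adj]; exact_mod_cast h

lemma entry {K : Set (MGPoint G)} (hK : IsClosed K) (hKc : IsPreconnected K) {r1 r2 : ℝ}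
    {γ : ℝ → MGPoint G} (hγ : Geo r1 r2 γ) (hr : r1 + 1 < r2) (h1 : γ r1 ∈ K) (h2 : γ r2 ∈ K)
    (hnotin : ∀ r, r1 < r → r < r2 → γ r ∉ K) :
    ∃ t0, r1 < t0 ∧ t0 ≤ r1 + 1 ∧ ∃ v u, mgVDist G v (γ t0) = 0 ∧ G.Adj u v ∧
      (∃ x ∈ K, mgVDist G u x = 0) ∧ mgVDist G u (γ r1) ≤ 1 - (t0 - r1) := by
  have m1 : r1 ∈ Set.Icc r1 r2 := ⟨le_rfl, by linarith⟩
  have m2 : r2 ∈ Set.Icc r1 r2 := ⟨by linarith, le_rfl⟩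
  have m3 : r1 + 1 ∈ Set.Icc r1 r2 := ⟨by linarith, by linarith⟩
  by_cases hv : ∃ w, mgVDist G w (γ r1) = 0
  · obtain ⟨w, hw⟩ := hv
    have hd : dist (γ r1) (γ (r1+1)) = 1 := by
      rw [hγ r1 m1 _ m3]; simp
    obtain ⟨v, hv⟩ := level_vertex (v := w) (n := 1) (q := γ (r1+1)) (by rw [vd_dist hw, hd]; simp)
    exact ⟨r1+1, by linarith, le_rfl, v, w, hv, adj_of_at hw hv hd, ⟨_, h1, hw⟩, by rw [hw]; linarith⟩
  · push Not at hv
    set q := γ r1 with hq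
    have c1 : dist (mgMid q) (γ r1) ≤ 1/2 := mid_self q
    have c2 : 1/2 ≤ dist (mgMid q) (γ (r1+1)) := by
      have hd : dist (γ r1) (γ (r1+1)) = 1 := by
        rw [hγ r1 m1 _ m3]; simp
      have := dist_triangle q (mgMid q) (γ (r1+1))
      rw [dist_comm q (mgMid q)] at this
      linarith
    have hc : ContinuousOn (fun r => dist (mgMid q) (γ r)) (Set.Icc r1 (r1+1)) := by
      have := (hγ.mono le_rfl hr.le).cont
      fun_prop
    obtain ⟨t0, ht0, hte⟩ := intermediate_value_Icc (by linarith) hc ⟨c1, c2⟩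
    have hlv := mid_level hte
    have hne : r1 ≠ t0 := by
      rintro rfl
      rcases hlv with h | h
      · exact hv _ h
      · exact hv _ h
    have hlt : r1 < t0 := lt_of_le_of_ne ht0.1 hne
    have hdist : dist (γ t0) q = t0 - r1 := by
      rw [hq, hγ t0 ⟨hlt.le, by linarith [ht0.2]⟩ r1 m1, abs_of_pos (by linarith)]
    have hnK : ∀ x ∈ K, ∀ w, mgVDist G w (γ t0) = 0 → mgVDist G w x ≠ 0 := by
      intro x hx w h h'
      exact hnotin t0 hlt (by linarith [ht0.2]) (closed_zero hK hx (at_zero h h'))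
    obtain ⟨x, hx, hxe⟩ := cross_edge hKc h1 h2 (by
      rw [hγ r1 m1 r2 m2, abs_sub_comm, abs_of_pos (by linarith)]; linarith)
    have e := adj_dist q
    have a := t_nonneg q
    have b := t_le_one q
    refine ⟨t0, hlt, ht0.2, ?_⟩
    rcases hlv with h | h
    · rcases hxe with h' | h'
      · exact absurd h' (hnK x hx _ h)
      · refine ⟨q.1.1, q.1.2.1, h, q.2.1.symm, ⟨x, hx, h'⟩, ?_⟩
        have g1 := vd_dist (q := q) h
        rw [hdist] at g1
        rcases mgVDist_cases q.1.1 q with g | g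
        · have := mgVDist_le_right q.1.2.1 q
          simp only [SimpleGraph.dist_self, Nat.cast_zero] at this g
          change mgVDist G q.1.2.1 q ≤ _
          linarith
        · have := mgVDist_le_right q.1.2.1 q
          simp only [SimpleGraph.dist_self, Nat.cast_zero] at this g
          have := mgVDist_le_left q.1.1 q
          simp only [SimpleGraph.dist_self, Nat.cast_zero] at this g
          change mgVDist G q.1.2.1 q ≤ _
          linarith
    · rcases hxe with h' | h'
      · refine ⟨q.1.2.1, q.1.1, h, q.2.1, ⟨x, hx, h'⟩, ?_⟩
        have g1 := vd_dist (q := q) h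
        rw [hdist] at g1
        have e2 := e
        rw [SimpleGraph.dist_comm] at e2
        have g2 := mgVDist_le_left q.1.1 q
        have g3 := mgVDist_le_right q.1.2.1 q
        simp only [SimpleGraph.dist_self, Nat.cast_zero] at g2 g3
        change mgVDist G q.1.1 q ≤ _
        rcases mgVDist_cases q.1.2.1 q with g | g
        · linarith
        · simp only [SimpleGraph.dist_self, Nat.cast_zero] at g
          linarith
      · exact absurd h' (hnK x hx _ h)

/-- The cycle made of a geodesic excursion away from a connected set, closed up in the set. -/
lemma excursion {K : Set (MGPoint G)} (hK : IsClosed K) (hKc : IsPreconnected K) {r1 r2 : ℝ}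
    {γ : ℝ → MGPoint G} (hγ : Geo r1 r2 γ) (hr : r1 + 3/2 < r2) (h1 : γ r1 ∈ K) (h2 : γ r2 ∈ K)
    (hnotin : ∀ r, r1 < r → r < r2 → γ r ∉ K) :
    ∃ (t0 : ℝ) (n L : ℕ) (f : ℕ → V), IsCyc G L f ∧ r1 < t0 ∧ t0 + n < r2 ∧ n + 2 ≤ L ∧
      2 * (r2 - r1) ≤ L ∧ (∀ i ≤ n, mgVDist G (f i) (γ (t0 + i)) = 0) ∧
      (∀ i, n < i → i < L → ∃ q ∈ K, mgVDist G (f i) q = 0) ∧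
      mgVDist G (f (L - 1)) (γ r1) ≤ 1 - (t0 - r1) ∧
      mgVDist G (f (n + 1)) (γ r2) ≤ 1 - (r2 - (t0 + n)) := by
  obtain ⟨t0, ht0, ht0', v0, u, hv0, hadj, ⟨x, hxK, hxu⟩, hub⟩ :=
    entry hK hKc hγ (by linarith) h1 h2 hnotin
  obtain ⟨t1, ht1, ht1', vn, u', hvn, hadj', ⟨x', hxK', hxu'⟩, hub'⟩ :=
    entry hK hKc (γ := fun s => γ (-s)) hγ.rev (by linarith) (by simpa using h2) (by simpa using h1)
      (fun r hr1 hr2 => hnotin (-r) (by linarith) (by linarith))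
  simp only [neg_neg] at hvn hub'
  set n := G.dist v0 vn with hn
  have ht1e : -t1 = t0 + n := by
    have hd := dist_at hv0 hvn
    rw [hγ t0 ⟨ht0.le, by linarith⟩ (-t1) ⟨by linarith, by linarith⟩] at hd
    rcases le_total t0 (-t1) with h | h
    · rw [abs_of_nonpos (by linarith)] at hd; linarith
    · rw [abs_of_nonneg (by linarith)] at hd
      have : (n : ℝ) < 1 := by linarith
      have : n < 1 := by exact_mod_cast this
      have : n = 0 := by omega
      rw [← hn] at hd
      simp only [this, Nat.cast_zero] at hd ⊢
      linarith
  rw [ht1e] at hvn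
  have hnr : t0 + n < r2 := by linarith
  have hmem : ∀ i ≤ n, t0 + (i:ℝ) ∈ Set.Icc r1 r2 := by
    intro i hi
    have : (i:ℝ) ≤ n := by exact_mod_cast hi
    have : (0:ℝ) ≤ i := by positivity
    constructor <;> linarith
  have m0 : t0 ∈ Set.Icc r1 r2 := by simpa using hmem 0 (by omega)
  have hex : ∀ i : ℕ, ∃ w, i ≤ n → mgVDist G w (γ (t0 + i)) = 0 := by
    intro i
    by_cases hi : i ≤ n
    · obtain ⟨w, hw⟩ := level_vertex (v := v0) (n := i) (q := γ (t0 + i)) (by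
        rw [vd_dist hv0, hγ t0 m0 _ (hmem i hi)]; simp)
      exact ⟨w, fun _ => hw⟩
    · exact ⟨v0, fun h => absurd h hi⟩
  choose v hv using hex
  have hv00 : v 0 = v0 := at_uniq (hv 0 (by omega)) (by simpa using hv0)
  have hvnn : v n = vn := at_uniq (hv n le_rfl) hvn
  have hvadj : ∀ i, i < n → G.Adj (v i) (v (i+1)) := by
    intro i hi
    apply adj_of_at (hv i hi.le) (hv (i+1) hi)
    rw [hγ _ (hmem i hi.le) _ (hmem (i+1) hi)]
    push_cast
    rw [show t0 + (i:ℝ) - (t0 + (i + 1)) = -1 by ring]; simp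
  have hvinj : ∀ i ≤ n, ∀ j ≤ n, v i = v j → i = j := by
    intro i hi j hj hij
    have hd := at_zero (hv i hi) (hij ▸ hv j hj)
    rw [hγ _ (hmem i hi) _ (hmem j hj), abs_eq_zero] at hd
    have : (i:ℝ) = j := by linarith
    exact_mod_cast this
  have hvK : ∀ i ≤ n, ¬ ∃ q ∈ K, mgVDist G (v i) q = 0 := by
    rintro i hi ⟨q, hq, hqe⟩
    have : (i:ℝ) ≤ n := by exact_mod_cast hi
    have : (0:ℝ) ≤ i := by positivity
    exact hnotin _ (by linarith) (by linarith) (closed_zero hK hq (at_zero (hv i hi) hqe))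
  obtain ⟨w, hw, hwS⟩ := conn_reach hKc hxK' hxK hxu' hxu
  set l := w.length with hl
  set f : ℕ → V := fun i => if i ≤ n then v i else if i < n + 2 + l then w.getVert (i - n - 1)
    else v 0 with hf
  have f1 : ∀ i ≤ n, f i = v i := fun i hi => by simp [hf, hi]
  have f2 : ∀ i, n < i → i < n + 2 + l → f i = w.getVert (i - n - 1) := by
    intro i hi hi'
    simp [hf, not_le.2 hi, hi']
  have f3 : f (n + 2 + l) = v 0 := by
    simp only [hf]; rw [if_neg (by omega), if_neg (by omega)]
  have fK : ∀ i, n < i → i < n + 2 + l → ∃ q ∈ K, mgVDist G (f i) q = 0 := by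
    intro i hi hi'
    rw [f2 i hi hi']
    exact hwS _ (w.getVert_mem_support _)
  have hlen : 2 * (r2 - r1) ≤ (n + 2 + l : ℕ) := by
    have d1 := dist_le_vd u (γ r1) (γ r2)
    have d2 := mgVDist_tri hG.out u u' (γ r2)
    have d3 : (G.dist u u' : ℝ) ≤ l := by
      rw [G.dist_comm]; exact_mod_cast dist_le w
    rw [hγ r1 ⟨le_rfl, by linarith⟩ r2 ⟨by linarith, le_rfl⟩, abs_sub_comm,
      abs_of_pos (by linarith)] at d1
    push_cast
    linarith
  refine ⟨t0, n, n + 2 + l, f, ⟨?_, ?_, ?_, ?_⟩, ht0, hnr, by omega, hlen, ?_, fK, ?_, ?_⟩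
  · have : (2:ℝ) < (n + 2 + l : ℕ) := by linarith
    have : 2 < n + 2 + l := by exact_mod_cast this
    omega
  · intro i hi
    rcases lt_trichotomy i n with h | h | h
    · rw [f1 i h.le, f1 (i+1) h]; exact hvadj i h
    · rw [h]
      rw [f1 n le_rfl, f2 (n+1) (by omega) (by omega), hvnn]
      simpa using hadj'.symm
    · rw [f2 i h hi]
      by_cases h' : i + 1 < n + 2 + l
      · rw [f2 (i+1) (by omega) h', show i + 1 - n - 1 = (i - n - 1) + 1 by omega]
        exact w.adj_getVert_succ (by omega)
      · rw [show i + 1 = n + 2 + l by omega, f3, hv00, show i - n - 1 = w.length by omega,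
          w.getVert_length]
        exact hadj
  · rw [f3, f1 0 (by omega)]
  · intro i hi j hj hij
    by_cases hin : i ≤ n
    · by_cases hjn : j ≤ n
      · rw [f1 i hin, f1 j hjn] at hij; exact hvinj i hin j hjn hij
      · rw [f1 i hin] at hij
        exact absurd (hij ▸ fK j (by omega) hj) (hvK i hin)
    · by_cases hjn : j ≤ n
      · rw [f1 j hjn] at hij
        exact absurd (hij ▸ fK i (by omega) hi) (hvK j hjn)
      · rw [f2 i (by omega) hi, f2 j (by omega) hj] at hij
        have := hw.getVert_injOn (x₁ := i - n - 1) (x₂ := j - n - 1)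
          (by simp; omega) (by simp; omega) hij
        omega
  · intro i hi; rw [f1 i hi]; exact hv i hi
  · rw [f2 _ (by omega) (by omega), show n + 2 + l - 1 - n - 1 = w.length by omega,
      w.getVert_length]
    exact hub
  · rw [f2 _ (by omega) (by omega), show n + 1 - n - 1 = 0 by omega, w.getVert_zero]
    linarith

lemma first_hits {K : Set (MGPoint G)} (hK : IsClosed K) {a b s : ℝ}
    {γ : ℝ → MGPoint G} (hγ : Geo a b γ) (ha : γ a ∈ K) (hb : γ b ∈ K) (hs : s ∈ Set.Icc a b)
    {D : ℝ} (hD : ∀ q ∈ K, D < dist (γ s) q) :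
    ∃ r1 r2, a ≤ r1 ∧ r2 ≤ b ∧ r1 + D < s ∧ s + D < r2 ∧ γ r1 ∈ K ∧ γ r2 ∈ K ∧
      ∀ r, r1 < r → r < r2 → γ r ∉ K := by
  have c1 : IsCompact (Set.Icc a s ∩ γ ⁻¹' K) :=
    isCompact_Icc.of_isClosed_subset
      ((hγ.mono le_rfl hs.2).cont.preimage_isClosed_of_isClosed isClosed_Icc hK) inter_subset_left
  have c2 : IsCompact (Set.Icc s b ∩ γ ⁻¹' K) :=
    isCompact_Icc.of_isClosed_subset
      ((hγ.mono hs.1 le_rfl).cont.preimage_isClosed_of_isClosed isClosed_Icc hK) inter_subset_left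
  obtain ⟨r1, ⟨hr1, hr1K⟩, hmax⟩ := c1.exists_isGreatest ⟨a, ⟨le_rfl, hs.1⟩, ha⟩
  obtain ⟨r2, ⟨hr2, hr2K⟩, hmin⟩ := c2.exists_isLeast ⟨b, ⟨hs.2, le_rfl⟩, hb⟩
  have d1 := hD _ hr1K
  have d2 := hD _ hr2K
  rw [hγ s hs r1 ⟨hr1.1, hr1.2.trans hs.2⟩, abs_of_nonneg (by linarith [hr1.2])] at d1
  rw [hγ s hs r2 ⟨hs.1.trans hr2.1, hr2.2⟩, abs_of_nonpos (by linarith [hr2.1])] at d2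
  refine ⟨r1, r2, hr1.1, hr2.2, by linarith, by linarith, hr1K, hr2K, ?_⟩
  intro r h1 h2 hrK
  rcases le_total r s with h | h
  · have := hmax ⟨⟨by linarith [hr1.1], h⟩, hrK⟩; linarith
  · have := hmin ⟨⟨h, by linarith [hr2.2]⟩, hrK⟩; linarith

end upper

set_option linter.unusedSectionVars false
set_option linter.unusedDecidableInType false
set_option linter.unusedFintypeInType false

section upper2
variable {V : Type} [Fintype V] [DecidableEq V] {G : SimpleGraph V}

lemma IsCyc.dist_le {L : ℕ} {f : ℕ → V} (h : IsCyc G L f) {i j : ℕ} (hij : i ≤ j) (hj : j ≤ L) :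
    (G.dist (f i) (f j) : ℝ) ≤ (j:ℝ) - i := by
  obtain ⟨w, hw, -⟩ := seq_walk (G := G) f (j - i) i (fun l hl => h.2.1 (i + l) (by omega))
  have := SimpleGraph.dist_le w
  rw [hw, show i + (j - i) = j by omega] at this
  have h2 : ((j - i : ℕ) : ℝ) = (j:ℝ) - i := by push_cast [hij]; ring
  rw [← h2]; exact_mod_cast this

/-- The numerical assumption under which `D` bounds the hyperbolicity constant. -/
def GoodD (G : SimpleGraph V) (D : ℝ) : Prop :=
  3/4 ≤ D ∧ ((circumference G : ℝ) ≤ 4 * D ∨ ∃ (E : Finset (Sym2 V)) (k : ℕ),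
    (∀ e, e ∈ E ↔ e ∈ G.edgeSet) ∧ E.card = circumference G + k ∧ 0 < G.girth ∧
    G.girth < circumference G ∧ 4 * k < G.girth ∧
    4 * D = (circumference G : ℝ) - G.girth + 4 * k)

variable [hG : Fact G.Connected]

lemma near_core {D : ℝ} (hD : GoodD G D) {K : Set (MGPoint G)} (hK : IsClosed K)
    (hKc : IsPreconnected K) {a b s : ℝ} {γ : ℝ → MGPoint G} (hγ' : Geo a b γ) (ha : γ a ∈ K)
    (hb : γ b ∈ K) (hs : s ∈ Set.Icc a b) : ∃ q ∈ K, dist (γ s) q ≤ D := by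
  by_contra hcon
  push Not at hcon
  obtain ⟨hD0, hD⟩ := hD
  obtain ⟨r1, r2, har, hrb, hs1, hs2, h1, h2, hnotin⟩ := first_hits hK hγ' ha hb hs hcon
  have hγ := hγ'.mono har hrb
  obtain ⟨t0, n, L, f, hf, ht0, htn, hnL, hL, hfv, hfK, hb1, hb2⟩ :=
    excursion hK hKc hγ (by linarith) h1 h2 hnotin
  have hLc := hf.le_circ
  rcases hD with hD | ⟨E, k, hE, hcard, hg0, hgc, hk, hDe⟩
  · have : (L:ℝ) ≤ circumference G := by exact_mod_cast hLc
    linarith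
  · obtain ⟨f0, hf0⟩ := exists_cyc_circ (G := G) (by omega)
    obtain ⟨z, hz⟩ := exists_cyc_girth hg0
    have hkr : (0:ℝ) ≤ k := by positivity
    have heq : cycE (circumference G) f0 = cycE L f := by
      by_contra hne
      have := cyc_length_le hE hcard hf0 hf hne
      have : (L:ℝ) + G.girth ≤ circumference G + 2 * k := by exact_mod_cast this
      linarith
    have hLe : circumference G = L := by rw [← hf0.card_cycE, heq, hf.card_cycE]
    rw [hLe] at hcard hgc hDe
    obtain ⟨i, j, hij, hjL, hdk, hg1, hg2, -⟩ := shortcut hE hcard hf hz hgc (by omega)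
    have hdk' : (G.dist (f i) (f j) : ℝ) ≤ k := by exact_mod_cast hdk
    have hg1' : (G.girth : ℝ) ≤ k + ((j:ℝ) - i) := by
      have : ((j - i : ℕ) : ℝ) = (j:ℝ) - i := by push_cast [hij.le]; ring
      rw [← this]; exact_mod_cast hg1
    have hg2' : (G.girth : ℝ) ≤ k + (L - ((j:ℝ) - i)) := by
      have : ((L - (j - i) : ℕ) : ℝ) = L - ((j:ℝ) - i) := by
        rw [Nat.cast_sub (by omega), Nat.cast_sub hij.le]
      rw [← this]; exact_mod_cast hg2
    have hk4 : 4 * (k:ℝ) < G.girth := by exact_mod_cast hk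
    have hL1 : ((L - 1 : ℕ) : ℝ) = L - 1 := by rw [Nat.cast_sub (by omega)]; simp
    have hmem : ∀ i ≤ n, t0 + (i:ℝ) ∈ Set.Icc r1 r2 := by
      intro i hi
      have : (i:ℝ) ≤ n := by exact_mod_cast hi
      have : (0:ℝ) ≤ i := by positivity
      constructor <;> linarith
    have mr1 : r1 ∈ Set.Icc r1 r2 := ⟨le_rfl, by linarith⟩
    have mr2 : r2 ∈ Set.Icc r1 r2 := ⟨by linarith, le_rfl⟩
    have ms : s ∈ Set.Icc r1 r2 := ⟨by linarith, by linarith⟩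
    by_cases hjn : j ≤ n
    · have := dist_at (hfv i (by omega)) (hfv j hjn)
      rw [hγ _ (hmem i (by omega)) _ (hmem j hjn), abs_sub_comm, abs_of_nonneg (by
        have : (i:ℝ) ≤ j := by exact_mod_cast hij.le
        linarith)] at this
      linarith
    · push Not at hjn
      by_cases hin : i ≤ n
      · obtain ⟨q, hqK, hq⟩ := hfK j hjn hjL
        have hDs := hcon q hqK
        rw [_root_.dist_comm, ← vd_dist hq] at hDs
        have e1 := mgVDist_tri hG.out (f j) (f i) (γ s)
        rw [G.dist_comm, vd_dist (hfv i hin), hγ _ (hmem i hin) _ ms] at e1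
        rcases le_total s (t0 + i) with hsi | hsi
        · rw [abs_of_nonneg (by linarith)] at e1
          have e2 := mgVDist_tri hG.out (f i) (f j) (γ r1)
          have e3 := mgVDist_tri hG.out (f j) (f (L-1)) (γ r1)
          have e4 := hf.dist_le (i := j) (j := L - 1) (by omega) (by omega)
          rw [vd_dist (hfv i hin), hγ _ (hmem i hin) _ mr1, abs_of_nonneg (by linarith)] at e2
          linarith
        · rw [abs_of_nonpos (by linarith)] at e1
          have e2 := mgVDist_tri hG.out (f i) (f j) (γ r2)
          have e3 := mgVDist_tri hG.out (f j) (f (n+1)) (γ r2)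
          have e4 := hf.dist_le (i := n+1) (j := j) (by omega) (by omega)
          rw [G.dist_comm] at e4
          push_cast at e4
          rw [vd_dist (hfv i hin), hγ _ (hmem i hin) _ mr2, abs_of_nonpos (by linarith)] at e2
          linarith
      · push Not at hin
        have e0 := dist_le_vd (f (L-1)) (γ r1) (γ r2)
        have e1 := mgVDist_tri hG.out (f (L-1)) (f j) (γ r2)
        have e2 := mgVDist_tri hG.out (f j) (f i) (γ r2)
        have e3 := mgVDist_tri hG.out (f i) (f (n+1)) (γ r2)
        have e4 := hf.dist_le (i := j) (j := L - 1) (by omega) (by omega)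
        have e5 := hf.dist_le (i := n+1) (j := i) (by omega) (by omega)
        rw [G.dist_comm] at e4 e5
        rw [G.dist_comm] at hdk'
        push_cast at e5
        rw [hγ _ mr1 _ mr2, abs_of_nonpos (by linarith)] at e0
        linarith

lemma side_near {D ε : ℝ} (hD : GoodD G D) (hε : 0 < ε) {a1 b1 a2 b2 a3 b3 : ℝ}
    {g1 g2 g3 : ℝ → MGPoint G} (h1 : Geo a1 b1 g1) (h2 : Geo a2 b2 g2) (h3 : Geo a3 b3 g3)
    (h2' : a2 ≤ b2) (h3' : a3 ≤ b3)
    (e1 : dist (g1 b1) (g2 a2) = 0) (e2 : dist (g2 b2) (g3 a3) = 0)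
    (e3 : dist (g3 b3) (g1 a1) = 0) :
    ∀ s ∈ Set.Icc a1 b1, (∃ t ∈ Set.Icc a2 b2, dist (g1 s) (g2 t) ≤ D + ε) ∨
      (∃ t ∈ Set.Icc a3 b3, dist (g1 s) (g3 t) ≤ D + ε) := by
  intro s hs
  set A := closure (g2 '' Set.Icc a2 b2) with hA
  set B := closure (g3 '' Set.Icc a3 b3) with hB
  have mA : ∀ t ∈ Set.Icc a2 b2, g2 t ∈ A := fun t ht => subset_closure ⟨t, ht, rfl⟩
  have mB : ∀ t ∈ Set.Icc a3 b3, g3 t ∈ B := fun t ht => subset_closure ⟨t, ht, rfl⟩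
  have pA : IsPreconnected A := (isPreconnected_Icc.image _ h2.cont).closure
  have pB : IsPreconnected B := (isPreconnected_Icc.image _ h3.cont).closure
  have hK : IsClosed (A ∪ B) := isClosed_closure.union isClosed_closure
  have hKc : IsPreconnected (A ∪ B) := by
    apply IsPreconnected.union (g3 a3) _ (mB _ ⟨le_rfl, h3'⟩) pA pB
    apply closed_zero isClosed_closure (mA b2 ⟨h2', le_rfl⟩)
    rw [_root_.dist_comm]; exact e2
  obtain ⟨q, hq, hqd⟩ := near_core hD hK hKc h1
    (closed_zero hK (Or.inr (mB b3 ⟨h3', le_rfl⟩)) (by rw [_root_.dist_comm]; exact e3))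
    (closed_zero hK (Or.inl (mA a2 ⟨le_rfl, h2'⟩)) e1) hs
  rcases hq with hq | hq
  · left
    obtain ⟨_, ⟨t, ht, rfl⟩, hd⟩ := Metric.mem_closure_iff.1 hq ε hε
    exact ⟨t, ht, (dist_triangle _ q _).trans (by linarith)⟩
  · right
    obtain ⟨_, ⟨t, ht, rfl⟩, hd⟩ := Metric.mem_closure_iff.1 hq ε hε
    exact ⟨t, ht, (dist_triangle _ q _).trans (by linarith)⟩

lemma triangleDelta_le {D : ℝ} (hD : GoodD G D) (T : MGTriangle G) : triangleDelta T ≤ D := by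
  apply le_of_forall_pos_le_add
  intro ε hε
  have g1 : Geo T.a1 T.b1 T.g1 := T.h1.2
  have g2 : Geo T.a2 T.b2 T.g2 := T.h2.2
  have g3 : Geo T.a3 T.b3 T.g3 := T.h3.2
  apply csInf_le ⟨0, fun d hd => hd.1⟩
  refine ⟨by linarith [hD.1], side_near hD hε g1 g2 g3 T.h2.1 T.h3.1 T.glue1 T.glue2 T.glue3, ?_,
    side_near hD hε g3 g1 g2 T.h1.1 T.h2.1 T.glue3 T.glue1 T.glue2⟩
  intro s hs
  exact (side_near hD hε g2 g3 g1 T.h3.1 T.h1.1 T.glue2 T.glue3 T.glue1 s hs).symm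

lemma hyp_bdd {D : ℝ} (hD : GoodD G D) :
    BddAbove {d : ℝ | ∃ T : MGTriangle G, d = triangleDelta T} :=
  ⟨D, by rintro _ ⟨T, rfl⟩; exact triangleDelta_le hD T⟩

lemma hypDelta_le {D : ℝ} (hD : GoodD G D) : hypDelta G ≤ D := by
  apply Real.sSup_le
  · rintro _ ⟨T, rfl⟩; exact triangleDelta_le hD T
  · linarith [hD.1]

end upper2

set_option linter.unusedSectionVars false
set_option linter.unusedDecidableInType false
set_option linter.unusedFintypeInType false

section lower
variable {V : Type} [Fintype V] [DecidableEq V] {G : SimpleGraph V} [hG : Fact G.Connected]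

lemma geo_of_len {a b : ℝ} {γ : ℝ → MGPoint G} (hab : a ≤ b)
    (h : ∀ s ∈ Set.Icc a b, ∀ t ∈ Set.Icc a b, dist (γ s) (γ t) ≤ |s - t|)
    (hl : b - a ≤ dist (γ a) (γ b)) : IsMGGeodesic G a b γ := by
  have key : ∀ s ∈ Set.Icc a b, ∀ t ∈ Set.Icc a b, s ≤ t → dist (γ s) (γ t) = |s - t| := by
    intro s hs t ht hst
    apply le_antisymm (h s hs t ht)
    have h1 := h a ⟨le_rfl, hab⟩ s hs
    have h2 := h t ht b ⟨hab, le_rfl⟩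
    have h3 := dist_triangle4 (γ a) (γ s) (γ t) (γ b)
    rw [abs_of_nonpos (by linarith [hs.1])] at h1
    rw [abs_of_nonpos (by linarith [ht.2])] at h2
    rw [abs_of_nonpos (by linarith)]
    linarith
  refine ⟨hab, fun s hs t ht => ?_⟩
  rcases le_total s t with hst | hst
  · exact key s hs t ht hst
  · rw [mgDist_comm', abs_sub_comm]; exact key t ht s hs hst

/-- `P θ` is the point at parameter `θ` along the closed curve `f`. -/
def IsPar (c : ℕ) (f : ℕ → V) (P : ℝ → MGPoint G) : Prop :=
  ∀ θ : ℝ, 0 ≤ θ → θ ≤ c → ∃ i : ℕ, i < c ∧ (i:ℝ) ≤ θ ∧ θ ≤ i + 1 ∧ (P θ).1 = (f i, f (i+1), θ - i)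

lemma exists_par {c : ℕ} {f : ℕ → V} (hf : IsCyc G c f) : ∃ P : ℝ → MGPoint G, IsPar c f P := by
  have h3 := hf.1
  have h : ∀ θ : ℝ, ∃ p : MGPoint G, 0 ≤ θ → θ ≤ c →
      ∃ i : ℕ, i < c ∧ (i:ℝ) ≤ θ ∧ θ ≤ i + 1 ∧ p.1 = (f i, f (i+1), θ - i) := by
    intro θ
    by_cases hθ : 0 ≤ θ ∧ θ ≤ c
    · have : ∃ i : ℕ, i < c ∧ (i:ℝ) ≤ θ ∧ θ ≤ i + 1 := by
        rcases lt_or_eq_of_le hθ.2 with h | h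
        · exact ⟨⌊θ⌋₊, (Nat.floor_lt hθ.1).2 h, Nat.floor_le hθ.1, (Nat.lt_floor_add_one θ).le⟩
        · refine ⟨c - 1, by omega, ?_, ?_⟩ <;> rw [Nat.cast_sub (by omega)] <;> push_cast <;> linarith
      obtain ⟨i, hi, h1, h2⟩ := this
      exact ⟨⟨(f i, f (i+1), θ - i), hf.2.1 i hi, by constructor <;> simp <;> linarith⟩,
        fun _ _ => ⟨i, hi, h1, h2, rfl⟩⟩
    · refine ⟨⟨(f 0, f 1, 0), hf.2.1 0 (by omega), by simp⟩, fun a b => absurd ⟨a, b⟩ hθ⟩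
  choose P hP using h
  exact ⟨P, hP⟩

lemma par_le {c : ℕ} {f : ℕ → V} (hf : IsCyc G c f) {P : ℝ → MGPoint G} (hP : IsPar c f P)
    {a b : ℝ} (ha0 : 0 ≤ a) (ha : a ≤ c) (hb0 : 0 ≤ b) (hb : b ≤ c) :
    dist (P a) (P b) ≤ |a - b| := by
  have key : ∀ a b : ℝ, 0 ≤ a → a ≤ c → 0 ≤ b → b ≤ c → a ≤ b → dist (P a) (P b) ≤ |a - b| := by
    intro a b ha0 ha hb0 hb hab
    obtain ⟨i, hi, hi1, hi2, hie⟩ := hP a ha0 ha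
    obtain ⟨j, hj, hj1, hj2, hje⟩ := hP b hb0 hb
    rw [mg_dist_def]
    rcases lt_trichotomy i j with h | h | h
    · have h1 := mgDist_le_right (P a) (P b)
      have h2 := mgVDist_le_left (P a).1.2.1 (P b)
      have h3 := hf.dist_le (i := i+1) (j := j) h hj.le
      rw [hie, hje] at h2
      rw [hie] at h1
      simp only at h1 h2
      push_cast at h3
      rw [abs_of_nonpos (by linarith)]
      linarith
    · have h1 := mgDist_le_same (P a) (P b) (by rw [hie, hje, h]) (by rw [hie, hje, h])
      rw [hie, hje] at h1
      simp only [h] at h1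
      rwa [show a - (j:ℝ) - (b - j) = a - b by ring] at h1
    · have h1 := mgDist_le_left (P a) (P b)
      have h2 := mgVDist_le_right (P a).1.1 (P b)
      have hc : (j:ℝ) + 1 ≤ i := by exact_mod_cast h
      have h3 : (i:ℝ) = j + 1 := by linarith
      have h4 : i = j + 1 := by exact_mod_cast h3
      rw [hie, hje] at h2
      rw [hie] at h1
      simp only [h4, SimpleGraph.dist_self, Nat.cast_zero] at h1 h2
      push_cast at h1 h2
      have := abs_nonneg (a - b)
      linarith
  rcases le_total a b with h | h
  · exact key a b ha0 ha hb0 hb h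
  · rw [_root_.dist_comm, abs_sub_comm]; exact key b a hb0 hb ha0 ha h

lemma par_ge {c : ℕ} {f : ℕ → V} (hf : IsCyc G c f) {P : ℝ → MGPoint G} (hP : IsPar c f P)
    {M : ℝ → ℝ → ℝ} (hM1 : ∀ a b a' b', M a b ≤ |a - a'| + M a' b' + |b - b'|)
    (hM2 : ∀ a b, M a b ≤ |a - b|)
    (hM3 : ∀ i j : ℕ, i ≤ c → j ≤ c → M i j ≤ G.dist (f i) (f j))
    {a b : ℝ} (ha0 : 0 ≤ a) (ha : a ≤ c) (hb0 : 0 ≤ b) (hb : b ≤ c) :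
    M a b ≤ dist (P a) (P b) := by
  obtain ⟨i, hi, hi1, hi2, hie⟩ := hP a ha0 ha
  obtain ⟨j, hj, hj1, hj2, hje⟩ := hP b hb0 hb
  have ea1 : |a - (i:ℝ)| = a - i := abs_of_nonneg (by linarith)
  have ea2 : |a - ((i+1 : ℕ):ℝ)| = 1 - (a - i) := by
    push_cast; rw [abs_of_nonpos (by linarith)]; ring
  have eb1 : |b - (j:ℝ)| = b - j := abs_of_nonneg (by linarith)
  have eb2 : |b - ((j+1 : ℕ):ℝ)| = 1 - (b - j) := by
    push_cast; rw [abs_of_nonpos (by linarith)]; ring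
  rw [mg_dist_def]
  rcases mgDist_cases hG.out (P a) (P b) with ⟨h, h1, h2⟩ | ⟨h, h1, h2⟩ | h | h
  · rw [hie, hje] at h h1 h2
    simp only at h h1 h2
    have := hf.2.2.2 i hi j hj h1
    rw [h, this, show a - (j:ℝ) - (b - j) = a - b by ring]
    exact hM2 a b
  · rw [hie, hje] at h1 h2
    simp only at h1 h2
    have := hf.edge_inj hi hj (by rw [h1, h2]; exact Sym2.eq_swap)
    subst this
    exact absurd h1 (hf.2.1 i hi).ne
  · rw [h]
    rcases mgVDist_cases (P a).1.1 (P b) with g | g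
    · rw [g, hie, hje]
      have := hM3 i j (by omega) (by omega)
      have := hM1 a b i j
      simp only
      linarith
    · rw [g, hie, hje]
      have := hM3 i (j+1) (by omega) (by omega)
      have := hM1 a b i (j+1 : ℕ)
      simp only
      linarith
  · rw [h]
    rcases mgVDist_cases (P a).1.2.1 (P b) with g | g
    · rw [g, hie, hje]
      have := hM3 (i+1) j (by omega) (by omega)
      have := hM1 a b (i+1 : ℕ) j
      simp only
      linarith
    · rw [g, hie, hje]
      have := hM3 (i+1) (j+1) (by omega) (by omega)
      have := hM1 a b (i+1 : ℕ) (j+1 : ℕ)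
      simp only
      linarith

lemma par_close {c : ℕ} {f : ℕ → V} (hf : IsCyc G c f) {P : ℝ → MGPoint G} (hP : IsPar c f P) :
    dist (P c) (P 0) = 0 := by
  apply at_zero (u := f 0)
  · obtain ⟨i, hi, hi1, hi2, hie⟩ := hP c (by positivity) le_rfl
    have h1 : (c:ℝ) ≤ (i + 1 : ℕ) := by push_cast; exact hi2
    have h2 : c = i + 1 := by
      have : c ≤ i + 1 := by exact_mod_cast h1
      omega
    have := mgVDist_le_right (f 0) (P c)
    rw [hie] at this
    simp only at this
    rw [← h2, hf.2.2.1, SimpleGraph.dist_self, h2] at this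
    push_cast at this
    rw [h2]
    push_cast
    exact le_antisymm (by linarith) (mgVDist_nonneg _ _)
  · obtain ⟨i, hi, hi1, hi2, hie⟩ := hP 0 le_rfl (by positivity)
    have h2 : i = 0 := by exact_mod_cast le_antisymm hi1 (by positivity)
    have := mgVDist_le_left (f 0) (P 0)
    rw [hie, h2] at this
    simp only [SimpleGraph.dist_self] at this
    push_cast at this
    exact le_antisymm (by linarith) (mgVDist_nonneg _ _)

lemma lower_bound {c : ℕ} {f : ℕ → V} (hf : IsCyc G c f)
    {M : ℝ → ℝ → ℝ} (hM1 : ∀ a b a' b', M a b ≤ |a - a'| + M a' b' + |b - b'|)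
    (hM2 : ∀ a b, M a b ≤ |a - b|)
    (hM3 : ∀ i j : ℕ, i ≤ c → j ≤ c → M i j ≤ G.dist (f i) (f j))
    {x y p D : ℝ} (hx : 0 ≤ x) (hxp : x ≤ p) (hpy : p ≤ y) (hy : y = x + c/2) (hyc : y ≤ c)
    (hxy : (c:ℝ)/2 ≤ M x y) (hD1 : ∀ θ, 0 ≤ θ → θ ≤ x → D ≤ M p θ)
    (hD2 : ∀ θ, y ≤ θ → θ ≤ c → D ≤ M p θ) : D ≤ hypDelta G := by
  obtain ⟨P, hP⟩ := exists_par hf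
  have hle := fun {a b : ℝ} => par_le hf hP (a := a) (b := b)
  have hge := fun {a b : ℝ} => par_ge hf hP hM1 hM2 hM3 (a := a) (b := b)
  have hcl := par_close hf hP
  have hc0 : (0:ℝ) ≤ c := by positivity
  have hd := hge hx (by linarith) (by linarith) hyc (b := y)
  have G1 : IsMGGeodesic G x y P := by
    refine geo_of_len (by linarith) (fun s hs t ht => hle ?_ ?_ ?_ ?_) (by linarith) <;>
      linarith [hs.1, hs.2, ht.1, ht.2]
  have q1 := hle (a := x) (b := 0) hx (by linarith) le_rfl hc0
  have q2 := hle (a := c) (b := y) hc0 le_rfl (by linarith) hyc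
  rw [abs_of_nonneg (by linarith)] at q1 q2
  have q3 := dist_triangle4 (P x) (P 0) (P c) (P y)
  rw [_root_.dist_comm] at hcl
  have G2 : IsMGGeodesic G y c P := by
    refine geo_of_len (by linarith) (fun s hs t ht => hle ?_ ?_ ?_ ?_) ?_
    · linarith [hs.1, hs.2, ht.1, ht.2]
    · linarith [hs.1, hs.2, ht.1, ht.2]
    · linarith [hs.1, hs.2, ht.1, ht.2]
    · linarith [hs.1, hs.2, ht.1, ht.2]
    · rw [_root_.dist_comm]; linarith
  have G3 : IsMGGeodesic G 0 x P := by
    refine geo_of_len (by linarith) (fun s hs t ht => hle ?_ ?_ ?_ ?_) ?_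
    · linarith [hs.1, hs.2, ht.1, ht.2]
    · linarith [hs.1, hs.2, ht.1, ht.2]
    · linarith [hs.1, hs.2, ht.1, ht.2]
    · linarith [hs.1, hs.2, ht.1, ht.2]
    · rw [_root_.dist_comm]; linarith
  have gd : GoodD G ((circumference G : ℝ)/4) := by
    have : (3:ℝ) ≤ circumference G := by exact_mod_cast hf.1.trans hf.le_circ
    exact ⟨by linarith, Or.inl (by linarith)⟩
  let T : MGTriangle G :=
    { a1 := x, b1 := y, a2 := y, b2 := c, a3 := 0, b3 := x, g1 := P, g2 := P, g3 := P
      h1 := G1, h2 := G2, h3 := G3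
      glue1 := mgDist_self' _
      glue2 := by rw [mgDist_comm']; exact hcl
      glue3 := mgDist_self' _ }
  have hT : D ≤ triangleDelta T := by
    apply le_csInf
    · refine ⟨(circumference G : ℝ)/4 + 1, by positivity,
        side_near gd one_pos T.h1.2 T.h2.2 T.h3.2 T.h2.1 T.h3.1 T.glue1 T.glue2 T.glue3, ?_,
        side_near gd one_pos T.h3.2 T.h1.2 T.h2.2 T.h1.1 T.h2.1 T.glue3 T.glue1 T.glue2⟩
      intro s hs
      exact (side_near gd one_pos T.h2.2 T.h3.2 T.h1.2 T.h3.1 T.h1.1 T.glue2 T.glue3 T.glue1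
        s hs).symm
    · rintro d ⟨-, hd1, -⟩
      rcases hd1 p ⟨hxp, hpy⟩ with ⟨t, ht, htd⟩ | ⟨t, ht, htd⟩
      · have h1 : y ≤ t := ht.1
        have h2 : t ≤ c := ht.2
        exact ((hD2 t h1 h2).trans (hge (by linarith) (by linarith) (by linarith) h2)).trans htd
      · have h1 : 0 ≤ t := ht.1
        have h2 : t ≤ x := ht.2
        exact ((hD1 t h1 h2).trans (hge (by linarith) (by linarith) h1 (by linarith))).trans htd
  exact hT.trans (le_csSup (hyp_bdd gd) ⟨T, rfl⟩)

/-- Lower bound from a girth cycle. -/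
lemma lower_girth (hg : 0 < G.girth) : (G.girth : ℝ) / 4 ≤ hypDelta G := by
  obtain ⟨f, hf⟩ := exists_cyc_girth hg
  set c := G.girth with hc
  have hc3 : (3:ℝ) ≤ c := by exact_mod_cast hf.1
  refine lower_bound hf (M := fun a b => min |a - b| (c - |a - b|)) (x := 0) (y := c/2) (p := c/4)
    ?_ ?_ ?_ ?_ ?_ ?_ ?_ ?_ ?_ ?_ ?_
  · intro a b a' b'
    beta_reduce
    have h1 : |a - b| ≤ |a - a'| + |a' - b'| + |b - b'| := by
      have := abs_sub_le a a' b
      have := abs_sub_le a' b' b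
      rw [abs_sub_comm b b']; linarith
    have h2 : |a' - b'| ≤ |a - a'| + |a - b| + |b - b'| := by
      have := abs_sub_le a' a b'
      have := abs_sub_le a b b'
      rw [abs_sub_comm a a']; linarith
    rcases min_choice |a' - b'| (c - |a' - b'|) with h | h
    · rw [h]; exact (min_le_left _ _).trans h1
    · rw [h]; exact (min_le_right _ _).trans (by linarith)
  · intro a b; exact min_le_left _ _
  · have key : ∀ i j : ℕ, i ≤ j → j ≤ c → min |(i:ℝ) - j| (c - |(i:ℝ) - j|) ≤ G.dist (f i) (f j) := by
      intro i j hij hj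
      have hr : (i:ℝ) ≤ j := by exact_mod_cast hij
      have e : |(i:ℝ) - j| = ((j - i : ℕ) : ℝ) := by
        rw [abs_of_nonpos (by linarith), Nat.cast_sub hij]; ring
      have e2 : (c:ℝ) - ((j - i : ℕ) : ℝ) = ((c - (j - i) : ℕ) : ℝ) := by
        rw [Nat.cast_sub (n := c) (by omega)]
      rw [e, e2, ← Nat.cast_min]
      norm_cast
      rcases Nat.eq_or_lt_of_le hij with h | h
      · subst h; simp
      · rcases Nat.eq_or_lt_of_le hj with h' | h'
        · rw [h', hf.2.2.1]
          rcases Nat.eq_zero_or_pos i with h0 | h0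
          · subst h0; simp
          · have := girth_cyc_dist hG.out hf h0 (by omega)
            rw [G.dist_comm]
            omega
        · exact girth_cyc_dist hG.out hf h h'
    intro i j hi hj
    rcases le_total i j with h | h
    · exact key i j h hj
    · beta_reduce
      rw [abs_sub_comm, G.dist_comm]; exact key j i h hi
  · exact le_rfl
  · linarith
  · linarith
  · ring
  · linarith
  · beta_reduce
    rw [abs_of_nonpos (by linarith)]
    exact le_min (by linarith) (by linarith)
  · intro θ h0 h1
    have : θ = 0 := le_antisymm h1 h0
    subst this
    rw [abs_of_nonneg (by linarith)]
    exact le_min (by linarith) (by linarith)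
  · intro θ h0 h1
    rw [abs_of_nonpos (by linarith)]
    exact le_min (by linarith) (by linarith)

end lower

set_option linter.unusedSectionVars false
set_option linter.unusedDecidableInType false
set_option linter.unusedFintypeInType false
set_option linter.unusedSimpArgs false

section theta

/-- Directed adjacency of the theta graph with pendant edges. -/
def tR (α β N a b : ℕ) : Prop :=
  (a + 1 = b ∧ b < N) ∨ (a = 0 ∧ b = β) ∨ (a = α ∧ b + 1 = N) ∨ (a = 0 ∧ N ≤ b)

/-- The assumptions on the parameters. -/
def tOK (α β N : ℕ) : Prop := 1 ≤ α ∧ α < β ∧ β + 1 < N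

/-- The theta graph with pendant edges. -/
def tG (α β N e : ℕ) (h : tOK α β N) : SimpleGraph (Fin (N + e)) where
  Adj a b := tR α β N a.val b.val ∨ tR α β N b.val a.val
  symm := ⟨fun a b h => h.symm⟩
  loopless := ⟨fun a h' => by
    unfold tR at h'
    unfold tOK at h
    omega⟩

variable {α β N e : ℕ} (h : tOK α β N)

/-- The vertex with a given number. -/
def vx (h : tOK α β N) (e : ℕ) (a : ℕ) : Fin (N + e) :=
  ⟨a % (N + e), Nat.mod_lt _ (by unfold tOK at h; omega)⟩

lemma vx_val {a : ℕ} (ha : a < N + e) : (vx h e a).val = a := Nat.mod_eq_of_lt ha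

lemma vx_self (a : Fin (N + e)) : vx h e a.val = a := Fin.ext (vx_val h a.2)

lemma vx_inj {a b : ℕ} (ha : a < N + e) (hb : b < N + e) : vx h e a = vx h e b ↔ a = b := by
  rw [Fin.ext_iff, vx_val h ha, vx_val h hb]

lemma t_adj {a b : ℕ} (ha : a < N + e) (hb : b < N + e) :
    (tG α β N e h).Adj (vx h e a) (vx h e b) ↔ tR α β N a b ∨ tR α β N b a := by
  change tR α β N (vx h e a).val (vx h e b).val ∨ tR α β N (vx h e b).val (vx h e a).val ↔ _
  rw [vx_val h ha, vx_val h hb]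

lemma t_conn : (tG α β N e h).Connected := by
  have h' := h
  unfold tOK at h'
  have : Nonempty (Fin (N + e)) := ⟨vx h e 0⟩
  have h1 : ∀ a, a < N → (tG α β N e h).Reachable (vx h e 0) (vx h e a) := by
    intro a
    induction a with
    | zero => intro _; exact Reachable.refl _
    | succ a ih =>
      intro ha
      refine (ih (by omega)).trans (Adj.reachable ?_)
      rw [t_adj h (by omega) (by omega)]
      left; left; omega
  have h2 : ∀ a : Fin (N + e), (tG α β N e h).Reachable (vx h e 0) a := by
    intro a
    rw [← vx_self h a]
    by_cases ha : a.val < N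
    · exact h1 _ ha
    · apply Adj.reachable
      rw [t_adj h (by omega) a.2]
      left; unfold tR; omega
  exact ⟨fun a b => (h2 a).symm.trans (h2 b)⟩

/-- First end of edge number `t`. -/
def ed1 (α N t : ℕ) : ℕ := if t + 1 < N then t else if t = N then α else 0

/-- Second end of edge number `t`. -/
def ed2 (β N t : ℕ) : ℕ := if t + 1 < N then t + 1 else if t + 1 = N then β else t - 1

lemma ed_spec (t : ℕ) : (t + 1 < N ∧ ed1 α N t = t ∧ ed2 β N t = t + 1) ∨
    (t + 1 = N ∧ ed1 α N t = 0 ∧ ed2 β N t = β) ∨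
    (t = N ∧ ed1 α N t = α ∧ ed2 β N t = t - 1) ∨
    (N < t ∧ ed1 α N t = 0 ∧ ed2 β N t = t - 1) := by
  unfold ed1 ed2
  split_ifs <;> omega

/-- Edge number `t`. -/
def ed (h : tOK α β N) (e : ℕ) (t : ℕ) : Sym2 (Fin (N + e)) :=
  s(vx h e (ed1 α N t), vx h e (ed2 β N t))

lemma ed_lt (h : tOK α β N) {t : ℕ} (ht : t < N + 1 + e) : ed1 α N t < N + e ∧ ed2 β N t < N + e := by
  have h' := h
  unfold tOK at h'
  have := ed_spec (α := α) (β := β) (N := N) t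
  omega

lemma ed_inj {t u : ℕ} (ht : t < N + 1 + e) (hu : u < N + 1 + e) (he : ed h e t = ed h e u) :
    t = u := by
  have h' := h
  unfold tOK at h'
  have a1 := ed_lt h ht
  have a2 := ed_lt h hu
  have b1 := ed_spec (α := α) (β := β) (N := N) t
  have b2 := ed_spec (α := α) (β := β) (N := N) u
  unfold ed at he
  rw [Sym2.eq_iff, vx_inj h a1.1 a2.1, vx_inj h a1.2 a2.2, vx_inj h a1.1 a2.2,
    vx_inj h a1.2 a2.1] at he
  omega

lemma mem_edges (x : Sym2 (Fin (N + e))) :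
    x ∈ (tG α β N e h).edgeSet ↔ ∃ t < N + 1 + e, ed h e t = x := by
  have h' := h
  unfold tOK at h'
  constructor
  · induction x using Sym2.ind with
    | _ a b =>
    intro hab
    rw [SimpleGraph.mem_edgeSet] at hab
    have key : ∀ a b : Fin (N + e), tR α β N a.val b.val → ∃ t < N + 1 + e, ed h e t = s(a, b) := by
      intro a b hR
      have ha := a.2
      have hb := b.2
      have : ∃ t < N + 1 + e, ed1 α N t = a.val ∧ ed2 β N t = b.val := by
        rcases hR with hR | hR | hR | hR
        · have := ed_spec (α := α) (β := β) (N := N) a.val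
          exact ⟨a.val, by omega, by omega, by omega⟩
        · have := ed_spec (α := α) (β := β) (N := N) (N - 1)
          exact ⟨N - 1, by omega, by omega, by omega⟩
        · have := ed_spec (α := α) (β := β) (N := N) N
          exact ⟨N, by omega, by omega, by omega⟩
        · have := ed_spec (α := α) (β := β) (N := N) (b.val + 1)
          exact ⟨b.val + 1, by omega, by omega, by omega⟩
      obtain ⟨t, ht, h1, h2⟩ := this
      exact ⟨t, ht, by unfold ed; rw [h1, h2, vx_self, vx_self]⟩
    rcases hab with hab | hab
    · exact key a b hab
    · rw [Sym2.eq_swap]; exact key b a hab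
  · rintro ⟨t, ht, rfl⟩
    have a1 := ed_lt h ht
    unfold ed
    rw [SimpleGraph.mem_edgeSet, t_adj h a1.1 a1.2]
    have b1 := ed_spec (α := α) (β := β) (N := N) t
    unfold tR
    omega

lemma t_ncard : (tG α β N e h).edgeSet.ncard = N + 1 + e := by
  have : (tG α β N e h).edgeSet = ed h e '' (Finset.range (N + 1 + e) : Set ℕ) := by
    ext x
    rw [mem_edges]
    simp
  rw [this, Set.InjOn.ncard_image, Set.ncard_coe_finset, Finset.card_range]
  intro t ht u hu htu
  exact ed_inj h (by simpa using ht) (by simpa using hu) htu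

lemma even_three {P : ℕ → Prop} [DecidablePred P] {a b c : ℕ} (hab : a ≠ b) (hac : a ≠ c) (hbc : b ≠ c)
    (he : Even ((({a, b, c} : Finset ℕ).filter P).card)) : P a ↔ ¬ (P b ↔ P c) := by
  by_cases ha : P a <;> by_cases hb : P b <;> by_cases hc : P c <;>
    simp [Finset.filter_insert, Finset.filter_singleton, ha, hb, hc, hab, hac, hbc] at he ⊢
  exact absurd he (by decide)

open Classical in
/-- Possible cycle lengths. -/
lemma t_cyc {L : ℕ} {z : ℕ → Fin (N + e)} (hz : IsCyc (tG α β N e h) L z) :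
    L = β + 1 ∨ L = N - α ∨ L + β = α + 1 + N := by
  have h' := h
  unfold tOK at h'
  set Z := cycE L z with hZ
  set S := (Finset.range (N + 1 + e)).filter (fun t => ed h e t ∈ Z) with hS
  have himg : ∀ Q : Sym2 (Fin (N + e)) → Prop, (Z.filter Q).card =
      ((Finset.range (N + 1 + e)).filter (fun t => ed h e t ∈ Z ∧ Q (ed h e t))).card := by
    intro Q
    symm
    apply Finset.card_bij (fun t _ => ed h e t)
    · intro t ht
      simp only [Finset.mem_filter, Finset.mem_range] at ht ⊢
      exact ht.2
    · intro t ht u hu htu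
      simp only [Finset.mem_filter, Finset.mem_range] at ht hu
      exact ed_inj h ht.1 hu.1 htu
    · intro x hx
      simp only [Finset.mem_filter] at hx
      have : x ∈ (tG α β N e h).edgeSet := hz.cycE_sub x hx.1
      obtain ⟨t, ht, rfl⟩ := (mem_edges h x).1 this
      exact ⟨t, by simp only [Finset.mem_filter, Finset.mem_range]; exact ⟨ht, hx⟩, rfl⟩
  have hLS : L = S.card := by
    have := himg (fun _ => True)
    simp only [Finset.filter_true, and_true] at this
    rw [← hz.card_cycE]; exact this
  have hcr : ∀ (φ : Fin (N + e) → Prop) (t : ℕ), crossing φ (ed h e t) ↔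
      ¬ (φ (vx h e (ed1 α N t)) ↔ φ (vx h e (ed2 β N t))) := by
    intro φ t
    unfold ed
    exact crossing_iff φ _ _
  -- pendant edges are not used
  have hpend : ∀ t, N < t → t < N + 1 + e → ed h e t ∉ Z := by
    intro t h1 h2 h3
    have hp := hz.parity (fun w => w.val = t - 1)
    rw [← hZ, himg] at hp
    have : (Finset.range (N + 1 + e)).filter (fun u => ed h e u ∈ Z ∧
        crossing (fun w : Fin (N + e) => w.val = t - 1) (ed h e u)) = {t} := by
      ext u
      simp only [Finset.mem_filter, Finset.mem_range, Finset.mem_singleton, hcr]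
      constructor
      · rintro ⟨hu, -, hc⟩
        have a1 := ed_lt h hu
        rw [vx_val h a1.1, vx_val h a1.2] at hc
        have b1 := ed_spec (α := α) (β := β) (N := N) u
        omega
      · rintro rfl
        refine ⟨h2, h3, ?_⟩
        have a1 := ed_lt h h2
        rw [vx_val h a1.1, vx_val h a1.2]
        have b1 := ed_spec (α := α) (β := β) (N := N) u
        omega
    rw [this] at hp
    simp at hp
  have hpath : ∀ i, i + 1 < N → (ed h e i ∈ Z ↔
      ¬ ((ed h e (N - 1) ∈ Z ∧ i < β) ↔ (ed h e N ∈ Z ∧ α ≤ i))) := by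
    intro i hi
    have hp := hz.parity (fun w => i < w.val ∧ w.val < N)
    rw [← hZ, himg] at hp
    set P : ℕ → Prop := fun u => ed h e u ∈ Z ∧
      crossing (fun w : Fin (N + e) => i < w.val ∧ w.val < N) (ed h e u) with hP
    have hPi : ∀ u, u < N + 1 + e → (P u ↔ ed h e u ∈ Z ∧
        (u = i ∨ (u + 1 = N ∧ i < β) ∨ (u = N ∧ α ≤ i))) := by
      intro u hu
      simp only [hP, hcr]
      have a1 := ed_lt h hu
      rw [vx_val h a1.1, vx_val h a1.2]
      have b1 := ed_spec (α := α) (β := β) (N := N) u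
      refine and_congr_right (fun _ => ?_)
      omega
    have hset : (Finset.range (N + 1 + e)).filter P = ({i, N - 1, N} : Finset ℕ).filter P := by
      ext u
      simp only [Finset.mem_filter, Finset.mem_range, Finset.mem_insert, Finset.mem_singleton]
      constructor
      · rintro ⟨hu, hPu⟩
        refine ⟨?_, hPu⟩
        rw [hPi u hu] at hPu
        omega
      · rintro ⟨hu, hPu⟩
        exact ⟨by omega, hPu⟩
    rw [hset] at hp
    have := even_three (a := i) (b := N - 1) (c := N) (by omega) (by omega) (by omega) hp
    rw [hPi i (by omega), hPi (N-1) (by omega), hPi N (by omega)] at this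
    have e1 : (i = i ∨ (i + 1 = N ∧ i < β) ∨ (i = N ∧ α ≤ i)) ↔ True := by simp
    have e2 : (N - 1 = i ∨ (N - 1 + 1 = N ∧ i < β) ∨ (N - 1 = N ∧ α ≤ i)) ↔ i < β := by omega
    have e3 : (N = i ∨ (N + 1 = N ∧ i < β) ∨ (N = N ∧ α ≤ i)) ↔ α ≤ i := by omega
    rw [e1, e2, e3, and_true] at this
    exact this
  have hmem : ∀ t, t ∈ S ↔ t < N + 1 + e ∧ ed h e t ∈ Z := by
    intro t; simp [hS]
  by_cases c0 : ed h e (N - 1) ∈ Z <;> by_cases c1 : ed h e N ∈ Z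
  · right; right
    have : S = Finset.range α ∪ Finset.Ico β (N + 1) := by
      ext t
      rw [hmem]
      simp only [Finset.mem_union, Finset.mem_range, Finset.mem_Ico]
      rcases lt_trichotomy (t + 1) N with ht | ht | ht
      · rw [hpath t ht]; simp only [c0, c1, true_and, or_true, true_or, or_false, iff_true, iff_false, true_iff, false_iff, not_not, not_true_eq_false, not_false_eq_true]; omega
      · have : t = N - 1 := by omega
        rw [this]; simp only [c0, and_true, or_true, true_or, or_false, iff_true, iff_false, true_iff, false_iff, not_not, not_true_eq_false, not_false_eq_true]; omega
      · rcases Nat.eq_or_lt_of_le (show N ≤ t by omega) with ht' | ht'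
        · rw [← ht']; simp only [c1, and_true, or_true, true_or, or_false, iff_true, iff_false, true_iff, false_iff, not_not, not_true_eq_false, not_false_eq_true]; omega
        · have := hpend t ht'
          constructor
          · rintro ⟨q1, q2⟩; exact absurd q2 (this q1)
          · intro hq; omega
    rw [hLS, this, Finset.card_union_of_disjoint, Finset.card_range, Nat.card_Ico]
    · omega
    · rw [Finset.disjoint_left]; intro x; simp only [Finset.mem_range, Finset.mem_Ico]; omega
  · left
    have : S = Finset.range β ∪ {N - 1} := by
      ext t
      rw [hmem]
      simp only [Finset.mem_union, Finset.mem_range, Finset.mem_singleton]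
      rcases lt_trichotomy (t + 1) N with ht | ht | ht
      · rw [hpath t ht]; simp only [c0, c1, true_and, false_and, or_true, true_or, or_false, iff_true, iff_false, true_iff, false_iff, not_not, not_true_eq_false, not_false_eq_true]; omega
      · have : t = N - 1 := by omega
        rw [this]; simp only [c0, and_true, or_true, true_or, or_false, iff_true, iff_false, true_iff, false_iff, not_not, not_true_eq_false, not_false_eq_true]; omega
      · rcases Nat.eq_or_lt_of_le (show N ≤ t by omega) with ht' | ht'
        · rw [← ht']; simp only [c1, and_false, or_true, true_or, or_false, iff_true, iff_false, true_iff, false_iff, not_not, not_true_eq_false, not_false_eq_true]; omega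
        · have := hpend t ht'
          constructor
          · rintro ⟨q1, q2⟩; exact absurd q2 (this q1)
          · intro hq; omega
    rw [hLS, this, Finset.card_union_of_disjoint, Finset.card_range, Finset.card_singleton]
    rw [Finset.disjoint_left]; intro x; simp only [Finset.mem_range, Finset.mem_singleton]; omega
  · right; left
    have : S = Finset.Ico α (N - 1) ∪ {N} := by
      ext t
      rw [hmem]
      simp only [Finset.mem_union, Finset.mem_Ico, Finset.mem_singleton]
      rcases lt_trichotomy (t + 1) N with ht | ht | ht
      · rw [hpath t ht]; simp only [c0, c1, true_and, false_and, or_true, true_or, or_false, iff_true, iff_false, true_iff, false_iff, not_not, not_true_eq_false, not_false_eq_true]; omega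
      · have : t = N - 1 := by omega
        rw [this]; simp only [c0, and_false, or_true, true_or, or_false, iff_true, iff_false, true_iff, false_iff, not_not, not_true_eq_false, not_false_eq_true]; omega
      · rcases Nat.eq_or_lt_of_le (show N ≤ t by omega) with ht' | ht'
        · rw [← ht']; simp only [c1, and_true, or_true, true_or, or_false, iff_true, iff_false, true_iff, false_iff, not_not, not_true_eq_false, not_false_eq_true]; omega
        · have := hpend t ht'
          constructor
          · rintro ⟨q1, q2⟩; exact absurd q2 (this q1)
          · intro hq; omega
    rw [hLS, this, Finset.card_union_of_disjoint, Finset.card_singleton, Nat.card_Ico]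
    · omega
    · rw [Finset.disjoint_left]; intro x; simp only [Finset.mem_Ico, Finset.mem_singleton]; omega
  · exfalso
    have : S = ∅ := by
      ext t
      rw [hmem]
      simp only [Finset.notMem_empty, iff_false]
      rintro ⟨q1, q2⟩
      rcases lt_trichotomy (t + 1) N with ht | ht | ht
      · rw [hpath t ht] at q2; simp [c0, c1] at q2
      · have : t = N - 1 := by omega
        rw [this] at q2; exact c0 q2
      · rcases Nat.eq_or_lt_of_le (show N ≤ t by omega) with ht' | ht'
        · rw [← ht'] at q2; exact c1 q2
        · exact hpend t ht' q1 q2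
    rw [this] at hLS
    have := hz.1
    simp at hLS
    omega

/-- The short cycle. -/
lemma t_cyc1 : IsCyc (tG α β N e h) (β + 1) (fun i => vx h e (if i ≤ β then i else 0)) := by
  have h' := h
  unfold tOK at h'
  refine ⟨by omega, ?_, ?_, ?_⟩
  · intro i hi
    beta_reduce
    rw [t_adj h (by split_ifs <;> omega) (by split_ifs <;> omega)]
    unfold tR
    split_ifs <;> omega
  · simp
  · intro i hi j hj hij
    beta_reduce at hij
    rw [vx_inj h (by split_ifs <;> omega) (by split_ifs <;> omega)] at hij
    split_ifs at hij <;> omega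

/-- Numbering of the long cycle. -/
def tf (α β N i : ℕ) : ℕ := if i = 0 then α else if i + β ≤ N then N - i else i + β - N - 1

lemma tf_spec (i : ℕ) : (i = 0 ∧ tf α β N i = α) ∨ (1 ≤ i ∧ i + β ≤ N ∧ tf α β N i = N - i) ∨
    (1 ≤ i ∧ N < i + β ∧ tf α β N i = i + β - N - 1) := by
  unfold tf
  split_ifs <;> omega

/-- The long cycle. -/
lemma t_cyc2 : IsCyc (tG α β N e h) (α + 1 + N - β) (fun i => vx h e (tf α β N i)) := by
  have h' := h
  unfold tOK at h'
  have hlt : ∀ i ≤ α + 1 + N - β, tf α β N i < N + e := by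
    intro i hi
    unfold tf
    split_ifs <;> omega
  refine ⟨by omega, ?_, ?_, ?_⟩
  · intro i hi
    beta_reduce
    rw [t_adj h (hlt _ (by omega)) (hlt _ (by omega))]
    have s1 := tf_spec (α := α) (β := β) (N := N) i
    have s2 := tf_spec (α := α) (β := β) (N := N) (i + 1)
    unfold tR
    rcases s1 with s1 | s1 | s1 <;> rcases s2 with s2 | s2 | s2
    · exfalso; omega
    · left; right; right; left; omega
    · exfalso; omega
    · exfalso; omega
    · right; left; omega
    · right; right; left; omega
    · exfalso; omega
    · exfalso; omega
    · left; left; omega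
  · beta_reduce
    congr 1
    unfold tf
    split_ifs <;> omega
  · intro i hi j hj hij
    beta_reduce at hij
    rw [vx_inj h (hlt _ (by omega)) (hlt _ (by omega))] at hij
    unfold tf at hij
    split_ifs at hij <;> omega

lemma t_girth (h1 : β ≤ 2 * α + 1) (h2 : α + 1 + β ≤ N) : (tG α β N e h).girth = β + 1 := by
  have h' := h
  unfold tOK at h'
  have hle := (t_cyc1 (e := e) h).girth_le
  have hpos : 0 < (tG α β N e h).girth := by
    rw [Nat.pos_iff_ne_zero]
    intro h0
    rw [SimpleGraph.girth_eq_zero] at h0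
    obtain ⟨a, w, hw, -⟩ := (t_cyc1 (e := e) h).exists_walk
    exact h0 w hw
  obtain ⟨f, hf⟩ := exists_cyc_girth hpos
  have := t_cyc h hf
  omega

lemma t_circ (h1 : β ≤ 2 * α + 1) (h2 : α + 1 + β ≤ N) :
    circumference (tG α β N e h) = α + 1 + N - β := by
  have h' := h
  unfold tOK at h'
  have hle := (t_cyc2 (e := e) h).le_circ
  obtain ⟨f, hf⟩ := exists_cyc_circ (G := tG α β N e h) (by omega)
  have := t_cyc h hf
  omega

end theta

set_option linter.unusedSectionVars false
set_option linter.unusedDecidableInType false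
set_option linter.unusedFintypeInType false

section theta2

lemma lip_dist {V : Type} {G : SimpleGraph V} (hc : G.Connected) {φ : V → ℝ}
    (h1 : ∀ a b, G.Adj a b → φ b ≤ φ a + 1) (a b : V) : φ b ≤ φ a + G.dist a b := by
  obtain ⟨w, hw⟩ := hc.exists_walk_length_eq_dist a b
  rw [← hw]
  clear hw
  induction w with
  | nil => simp
  | cons hadj w ih =>
    have := h1 _ _ hadj
    rw [Walk.length_cons]
    push_cast
    linarith

variable {α β N e : ℕ} (h : tOK α β N)

/-- Extension of a function on the long cycle. -/
noncomputable def tH (α β N : ℕ) (H : ℕ → ℝ) (w : ℕ) : ℝ :=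
  if w ≤ α then H (w + (N - β) + 1)
  else if w < β then min (H 0 + ((w : ℝ) - α)) (H (N - β) + ((β : ℝ) - w))
  else if w < N then H (N - w)
  else H (N - β + 1)

lemma t_lip {H : ℕ → ℝ} (h1 : ∀ j, j < α + 1 + N - β → |H (j + 1) - H j| ≤ 1)
    (h2 : H (α + 1 + N - β) = H 0) (h3 : |H 0 - H (N - β)| ≤ (β : ℝ) - α) {i j : ℕ}
    (hi : i ≤ α + 1 + N - β) (hj : j ≤ α + 1 + N - β) :
    H j ≤ H i + (tG α β N e h).dist (vx h e (tf α β N i)) (vx h e (tf α β N j)) := by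
  have h' := h
  unfold tOK at h'
  have hlt : ∀ i ≤ α + 1 + N - β, tf α β N i < N + e := by
    intro i hi
    have := tf_spec (α := α) (β := β) (N := N) i
    omega
  have hval : ∀ i ≤ α + 1 + N - β, tH α β N H (tf α β N i) = H i := by
    intro i hi
    unfold tH
    rcases tf_spec (α := α) (β := β) (N := N) i with s | s | s
    · rw [s.2, if_pos le_rfl, s.1, ← h2]; congr 1; omega
    · rw [s.2.2, if_neg (by omega), if_neg (by omega), if_pos (by omega)]; congr 1; omega
    · rw [s.2.2, if_pos (by omega)]; congr 1; omega
  have hR : ∀ a b, tR α β N a b → |tH α β N H a - tH α β N H b| ≤ 1 := by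
    intro a b hab
    rw [abs_le] at h3
    rcases hab with hab | hab | hab | hab
    · obtain ⟨rfl, hb⟩ := hab
      rcases lt_trichotomy a α with ha | ha | ha
      · have := h1 (a + (N - β) + 1) (by omega)
        unfold tH
        rw [if_pos (by omega), if_pos (by omega), abs_sub_comm]
        convert this using 4
        omega
      · subst ha
        have e1 : tH a β N H a = H 0 := by
          unfold tH
          rw [if_pos le_rfl, ← h2]; congr 1; omega
        rw [e1]
        unfold tH
        rw [if_neg (by omega)]
        by_cases hab : a + 1 < β
        · rw [if_pos hab]
          push_cast
          rw [abs_le]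
          rcases min_cases (H 0 + ((a : ℝ) + 1 - a)) (H (N - β) + (β - ((a : ℝ) + 1))) with q | q <;>
            rw [q.1] <;> constructor <;> linarith
        · rw [if_neg hab, if_pos (by omega)]
          have hb' : β = a + 1 := by omega
          subst hb'
          push_cast at h3
          rw [abs_le]
          constructor <;> linarith
      · by_cases hab : a + 1 < β
        · unfold tH
          rw [if_neg (by omega), if_pos (by omega), if_neg (by omega), if_pos (by omega)]
          push_cast
          rw [abs_le]
          rcases min_cases (H 0 + ((a : ℝ) - α)) (H (N - β) + (β - (a : ℝ))) with q | q <;>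
          rcases min_cases (H 0 + ((a : ℝ) + 1 - α)) (H (N - β) + (β - ((a : ℝ) + 1))) with q' | q' <;>
            rw [q.1, q'.1] <;> constructor <;> linarith
        · by_cases hab' : a + 1 = β
          · subst hab'
            unfold tH
            rw [if_neg (by omega), if_pos (by omega), if_neg (by omega), if_neg (by omega),
              if_pos (by omega)]
            push_cast at h3 ⊢
            rw [abs_le]
            rcases min_cases (H 0 + ((a : ℝ) - α)) (H (N - (a + 1)) + ((a : ℝ) + 1 - (a : ℝ))) with q | q <;>
              rw [q.1] <;> constructor <;> linarith
          · have := h1 (N - (a + 1)) (by omega)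
            unfold tH
            rw [if_neg (by omega), if_neg (by omega), if_pos (by omega), if_neg (by omega),
              if_neg (by omega), if_pos (by omega)]
            convert this using 4
            omega
    · obtain ⟨rfl, rfl⟩ := hab
      have := h1 (N - b) (by omega)
      unfold tH
      rw [if_pos (by omega), if_neg (by omega), if_neg (by omega), if_pos (by omega)]
      convert this using 4
      omega
    · obtain ⟨rfl, hb⟩ := hab
      have := h1 0 (by omega)
      unfold tH
      rw [if_pos (by omega), if_neg (by omega), if_neg (by omega), if_pos (by omega), abs_sub_comm]
      rw [← h2] at this
      convert this using 4 <;> omega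
    · obtain ⟨rfl, hb⟩ := hab
      unfold tH
      rw [if_pos (by omega), if_neg (by omega), if_neg (by omega), if_neg (by omega)]
      simp
  have := lip_dist (t_conn (e := e) h) (φ := fun v => tH α β N H v.val) (by
    intro a b hab
    rcases hab with hab | hab <;>
    · have := hR _ _ hab
      rw [abs_le] at this
      linarith) (vx h e (tf α β N i)) (vx h e (tf α β N j))
  beta_reduce at this
  rw [vx_val h (hlt i hi), vx_val h (hlt j hj), hval i hi, hval j hj] at this
  exact this

/-- Lower bound for the distance in the theta graph. -/
noncomputable def tM (p c r : ℝ) (x y : ℝ) : ℝ :=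
  min (min |x - y| (c - |x - y|))
    (min (min |x| |c - x| + p + |y - r|) (|x - r| + p + min |y| |c - y|))

lemma tM_lip (p c r : ℝ) (a b a' b' : ℝ) :
    tM p c r a b ≤ |a - a'| + tM p c r a' b' + |b - b'| := by
  have k1 : |a - b| ≤ |a - a'| + |a' - b'| + |b - b'| := by
    have := abs_sub_le a a' b
    have := abs_sub_le a' b' b
    have := abs_sub_comm b b'
    linarith
  have k2 : |a' - b'| ≤ |a - a'| + |a - b| + |b - b'| := by
    have := abs_sub_le a' a b'
    have := abs_sub_le a b b'
    have := abs_sub_comm a a'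
    linarith
  have kk : ∀ u v w : ℝ, |u - w| ≤ |u - v| + |v - w| := fun u v w => abs_sub_le u v w
  have kA : ∀ u v : ℝ, min |u| |c - u| ≤ |u - v| + min |v| |c - v| := by
    intro u v
    have q1 := kk u v 0
    have q2 := kk c v u
    rw [sub_zero, sub_zero] at q1
    rw [abs_sub_comm v u] at q2
    rcases min_cases |v| |c - v| with q | q <;> rw [q.1]
    · exact (min_le_left _ _).trans q1
    · exact (min_le_right _ _).trans (by linarith)
  have l1 := kA a a'
  have l2 := kA b b'
  have l3 := kk a a' r
  have l4 := kk b b' r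
  unfold tM
  have hmin : ∀ (s A B C D A' B' C' D' : ℝ), A ≤ s + A' → B ≤ s + B' → C ≤ s + C' → D ≤ s + D' →
      min (min A B) (min C D) ≤ s + min (min A' B') (min C' D') := by
    intro s A B C D A' B' C' D' g1 g2 g3 g4
    have w1 : min (min A B) (min C D) ≤ A := (min_le_left _ _).trans (min_le_left _ _)
    have w2 : min (min A B) (min C D) ≤ B := (min_le_left _ _).trans (min_le_right _ _)
    have w3 : min (min A B) (min C D) ≤ C := (min_le_right _ _).trans (min_le_left _ _)
    have w4 : min (min A B) (min C D) ≤ D := (min_le_right _ _).trans (min_le_right _ _)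
    rcases min_cases (min A' B') (min C' D') with q | q <;> rw [q.1]
    · rcases min_cases A' B' with q | q <;> rw [q.1] <;> linarith
    · rcases min_cases C' D' with q | q <;> rw [q.1] <;> linarith
  have := hmin (|a - a'| + |b - b'|) |a - b| (c - |a - b|)
    (min |a| |c - a| + p + |b - r|) (|a - r| + p + min |b| |c - b|)
    |a' - b'| (c - |a' - b'|)
    (min |a'| |c - a'| + p + |b' - r|) (|a' - r| + p + min |b'| |c - b'|)
    (by linarith) (by linarith) (by linarith) (by linarith)
  linarith

lemma tM_le (p c r a b : ℝ) : tM p c r a b ≤ |a - b| :=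
  (min_le_left _ _).trans (min_le_left _ _)

lemma le_tM {p c r a b D : ℝ} (h1 : D ≤ |a - b|) (h2 : D ≤ c - |a - b|)
    (h3 : D ≤ |a| + p + |b - r|) (h4 : D ≤ |c - a| + p + |b - r|)
    (h5 : D ≤ |a - r| + p + |b|) (h6 : D ≤ |a - r| + p + |c - b|) : D ≤ tM p c r a b := by
  unfold tM
  refine le_min (le_min h1 h2) (le_min ?_ ?_)
  · rcases min_cases |a| |c - a| with q | q <;> rw [q.1] <;> assumption
  · rcases min_cases |b| |c - b| with q | q <;> rw [q.1] <;> assumption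

lemma tM_dist {i j : ℕ} (hi : i ≤ α + 1 + N - β) (hj : j ≤ α + 1 + N - β) (hp : β ≤ 2 * α + 1)
    (hr : α + 1 + β ≤ N) :
    tM ((β : ℝ) - α) ((α : ℝ) + 1 + N - β) ((N : ℝ) - β) i j ≤
      (tG α β N e h).dist (vx h e (tf α β N i)) (vx h e (tf α β N j)) := by
  have h' := h
  unfold tOK at h'
  have cc : ((α + 1 + N - β : ℕ) : ℝ) = (α : ℝ) + 1 + N - β := by
    rw [Nat.cast_sub (by omega)]; push_cast; ring
  have cr : ((N - β : ℕ) : ℝ) = (N : ℝ) - β := by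
    rw [Nat.cast_sub (by omega)]
  have hi' : (i : ℝ) ≤ (α : ℝ) + 1 + N - β := by rw [← cc]; exact_mod_cast hi
  have hi0 : (0 : ℝ) ≤ i := by positivity
  have hp0 : (1 : ℝ) ≤ (β : ℝ) - α := by
    have : ((α + 1 : ℕ) : ℝ) ≤ β := by exact_mod_cast (show α + 1 ≤ β by omega)
    push_cast at this; linarith
  have hp1 : (β : ℝ) ≤ 2 * α + 1 := by exact_mod_cast hp
  have hr1 : (α : ℝ) + 1 + β ≤ N := by exact_mod_cast hr
  set p : ℝ := (β : ℝ) - α with hpdef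
  set r : ℝ := (N : ℝ) - β with hrdef
  set c : ℝ := (α : ℝ) + 1 + N - β with hcdef
  have hrc : r ≤ c := by rw [hrdef, hcdef]; have : (0:ℝ) ≤ α := by positivity
                         linarith
  have hr0 : 0 ≤ r := by rw [hrdef]; have : (0:ℝ) ≤ α := by positivity
                         linarith
  have key := t_lip (e := e) h (H := fun j => tM p c r i j) (by
    intro j hj
    rw [abs_le]
    have q1 := tM_lip p c r i ((j + 1 : ℕ) : ℝ) i (j : ℝ)
    have q2 := tM_lip p c r i (j : ℝ) i ((j + 1 : ℕ) : ℝ)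
    have e1 : |((j + 1 : ℕ) : ℝ) - (j : ℝ)| = 1 := by push_cast; simp
    rw [sub_self, abs_zero, e1] at q1
    rw [sub_self, abs_zero, abs_sub_comm, e1] at q2
    constructor <;> linarith) (by
    beta_reduce
    rw [cc]
    unfold tM
    simp only [Nat.cast_zero, sub_self, sub_zero, abs_zero, zero_sub, abs_neg]
    rw [abs_of_nonneg hi0, abs_of_nonpos (show (i : ℝ) - c ≤ 0 by linarith),
      abs_of_nonneg (show 0 ≤ c by linarith), abs_of_nonneg (show 0 ≤ c - r by linarith),
      abs_of_nonneg hr0, abs_of_nonneg (show 0 ≤ c - i by linarith),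
      min_eq_right (show (0 : ℝ) ≤ c by linarith), min_eq_left (show (0 : ℝ) ≤ c by linarith)]
    have m1 : min (min (i : ℝ) (c - i)) (min (min (i : ℝ) (c - i) + p + r) (|(i : ℝ) - r| + p + 0)) =
      min (min (i : ℝ) (c - i)) (|(i : ℝ) - r| + p + 0) := by
      rw [← min_assoc, min_eq_left (show min (i : ℝ) (c - i) ≤ min (i : ℝ) (c - i) + p + r by linarith)]
    have m2 : min (min (i : ℝ) (c - i)) (min (min (i : ℝ) (c - i) + p + (c - r)) (|(i : ℝ) - r| + p + 0)) =
      min (min (i : ℝ) (c - i)) (|(i : ℝ) - r| + p + 0) := by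
      rw [← min_assoc, min_eq_left (show min (i : ℝ) (c - i) ≤ min (i : ℝ) (c - i) + p + (c - r) by linarith)]
    rw [m1, ← m2]
    congr 1
    rw [show -((i : ℝ) - c) = c - i by ring, show c - (c - (i : ℝ)) = i by ring, min_comm]) (by
    beta_reduce
    rw [cr]
    have u0 : tM p c r i ((0 : ℕ) : ℝ) ≤ min (i : ℝ) (c - i) := by
      unfold tM
      rw [Nat.cast_zero, sub_zero, abs_of_nonneg hi0]
      exact min_le_left _ _
    have u1 : tM p c r i ((0 : ℕ) : ℝ) ≤ |(i : ℝ) - r| + p := by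
      refine (min_le_right _ _).trans ((min_le_right _ _).trans ?_)
      rw [Nat.cast_zero, abs_zero]
      have := min_le_left (0 : ℝ) |c - 0|
      linarith
    have v1 : tM p c r i r ≤ |(i : ℝ) - r| := tM_le _ _ _ _ _
    have v2 : tM p c r i r ≤ min (i : ℝ) (c - i) + p := by
      refine (min_le_right _ _).trans ((min_le_left _ _).trans ?_)
      rw [abs_of_nonneg hi0, abs_of_nonneg (show 0 ≤ c - i by linarith), sub_self, abs_zero]
      linarith
    have y3 := min_le_left (i : ℝ) (c - i)
    have y4 := min_le_right (i : ℝ) (c - i)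
    have y5 := abs_nonneg ((i : ℝ) - r)
    have y6 := abs_nonneg (c - r)
    have y7 : |(i : ℝ)| = i := abs_of_nonneg hi0
    have y8 : |c - (i : ℝ)| = c - i := abs_of_nonneg (by linarith)
    have w0 : tM p c r i ((0 : ℕ) : ℝ) - p ≤ tM p c r i r := by
      apply le_tM
      · linarith
      · rcases abs_cases ((i : ℝ) - r) with q | q <;> linarith
      · rw [sub_self, abs_zero]; linarith
      · rw [sub_self, abs_zero]; linarith
      · rw [abs_of_nonneg hr0]; linarith
      · linarith
    have w1 : tM p c r i r - p ≤ tM p c r i ((0 : ℕ) : ℝ) := by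
      rw [Nat.cast_zero]
      apply le_tM
      · rw [sub_zero]; linarith
      · rw [sub_zero]; linarith
      · have := abs_nonneg (0 - r); linarith
      · have := abs_nonneg (0 - r); linarith
      · rw [abs_zero]; linarith
      · have := abs_nonneg (c - 0); linarith
    rw [abs_le]
    constructor <;> linarith) hi hj
  have k0 : tM p c r i i ≤ 0 := by
    have := tM_le p c r i i
    simpa using this
  beta_reduce at key
  linarith

lemma t_lower (hp : β ≤ 2 * α + 1) (hr : α + 1 + β ≤ N) {D : ℝ}
    (hD1 : 4 * D ≤ (α : ℝ) + 1 + N - β) (hD2 : 4 * D ≤ ((N : ℝ) - β) + 3 * ((β : ℝ) - α))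
    (hD0 : 0 ≤ D) :
    D ≤ hypDelta (tG α β N e h) := by
  have h' := h
  unfold tOK at h'
  haveI : Fact (tG α β N e h).Connected := ⟨t_conn h⟩
  have cc : ((α + 1 + N - β : ℕ) : ℝ) = (α : ℝ) + 1 + N - β := by
    rw [Nat.cast_sub (by omega)]; push_cast; ring
  have hp0 : (1 : ℝ) ≤ (β : ℝ) - α := by
    have : ((α + 1 : ℕ) : ℝ) ≤ β := by exact_mod_cast (show α + 1 ≤ β by omega)
    push_cast at this; linarith
  have hp1 : (β : ℝ) ≤ 2 * α + 1 := by exact_mod_cast hp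
  have hr1 : (α : ℝ) + 1 + β ≤ N := by exact_mod_cast hr
  have hα : (0 : ℝ) ≤ α := by positivity
  obtain ⟨p, hpdef⟩ : ∃ p : ℝ, p = (β : ℝ) - α := ⟨_, rfl⟩
  obtain ⟨r, hrdef⟩ : ∃ r : ℝ, r = (N : ℝ) - β := ⟨_, rfl⟩
  obtain ⟨c, hcdef⟩ : ∃ c : ℝ, c = (α : ℝ) + 1 + N - β := ⟨_, rfl⟩
  rw [← hcdef] at hD1
  rw [← hrdef, ← hpdef] at hD2
  have hpq : p ≤ c - r := by linarith
  have hqr : c - r ≤ r := by linarith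
  rw [← hpdef] at hp0
  refine lower_bound (t_cyc2 (e := e) h) (M := tM p c r) (x := (r - p) / 2)
    (y := (r - p) / 2 + c / 2) (p := (r - p) / 2 + D) (D := D)
    (tM_lip p c r) (tM_le p c r) ?_ ?_ ?_ ?_ ?_ ?_ ?_ ?_ ?_
  · intro i j hi hj
    rw [hpdef, hrdef, hcdef]
    exact tM_dist h hi hj hp hr
  · linarith
  · linarith
  · linarith
  · rw [cc, ← hcdef]
  · rw [cc, ← hcdef]; linarith
  · rw [cc, ← hcdef]
    have a1 : |(r - p) / 2 - ((r - p) / 2 + c / 2)| = c / 2 := by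
      rw [abs_of_nonpos (by linarith)]; ring
    have a2 := le_abs_self ((r - p) / 2)
    have a3 := le_abs_self (c - (r - p) / 2)
    have a4 := le_abs_self ((r - p) / 2 + c / 2 - r)
    have a5 := neg_abs_le ((r - p) / 2 - r)
    have a6 := le_abs_self (c - ((r - p) / 2 + c / 2))
    have a7 := le_abs_self ((r - p) / 2 + c / 2)
    apply le_tM <;> linarith
  · intro θ h0 h1
    have a1 : |(r - p) / 2 + D - θ| = (r - p) / 2 + D - θ := abs_of_nonneg (by linarith)
    have a2 := le_abs_self ((r - p) / 2 + D)
    have a3 := le_abs_self (c - ((r - p) / 2 + D))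
    have a4 := neg_abs_le (θ - r)
    have a5 := neg_abs_le ((r - p) / 2 + D - r)
    have a6 := le_abs_self (c - θ)
    have a7 := le_abs_self θ
    apply le_tM <;> linarith
  · rw [cc, ← hcdef]
    intro θ h0 h1
    have a1 : |(r - p) / 2 + D - θ| = θ - ((r - p) / 2 + D) := by
      rw [abs_of_nonpos (by linarith)]; ring
    have a2 := le_abs_self ((r - p) / 2 + D)
    have a3 := le_abs_self (c - ((r - p) / 2 + D))
    have a4 := abs_nonneg (θ - r)
    have a5 := neg_abs_le ((r - p) / 2 + D - r)
    have a6 := abs_nonneg (c - θ)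
    have a7 := le_abs_self θ
    apply le_tM <;> linarith

end theta2

lemma theta_exists (p q r e : ℕ) (hp : 1 ≤ p) (hpq : p ≤ q) (hq : 2 ≤ q) (hqr : q ≤ r) {D : ℝ}
    (hD0 : 0 ≤ D) (hD1 : 4 * D ≤ (q : ℝ) + r) (hD2 : 4 * D ≤ (r : ℝ) + 3 * p) :
    ∃ (n : ℕ) (G : SimpleGraph (Fin n)), memHclass (p + q) (q + r) (p + q + r + e) G ∧
      D ≤ hypDelta G := by
  obtain ⟨α, rfl⟩ : ∃ α, q = α + 1 := ⟨q - 1, by omega⟩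
  have h : tOK α (p + α) (p + α + r) := by unfold tOK; omega
  refine ⟨_, tG α (p + α) (p + α + r) e h, ⟨t_conn h, ?_, ?_, ?_⟩, ?_⟩
  · rw [t_girth h (by omega) (by omega)]; ring
  · rw [t_circ h (by omega) (by omega)]; omega
  · rw [t_ncard]; omega
  · push_cast at hD1
    refine t_lower h (by omega) (by omega) ?_ ?_ hD0 <;> push_cast <;> linarith


/-- Combining upper and lower bounds. -/
lemma beta_eq {g c m : ℕ} {D : ℝ}
    (hu : ∀ (k : ℕ) (G : SimpleGraph (Fin k)), memHclass g c m G → GoodD G D)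
    (hl : ∃ (k : ℕ) (G : SimpleGraph (Fin k)), memHclass g c m G ∧ D ≤ hypDelta G) :
    betagcm g c m = D := by
  have hub : ∀ d ∈ {d : ℝ | ∃ (k : ℕ) (G : SimpleGraph (Fin k)), memHclass g c m G ∧ d = hypDelta G},
      d ≤ D := by
    rintro d ⟨k, G, hG, rfl⟩
    have : Fact G.Connected := ⟨hG.1⟩
    exact hypDelta_le (hu k G hG)
  obtain ⟨k, G, hG, hle⟩ := hl
  unfold betagcm
  apply le_antisymm
  · exact csSup_le ⟨_, k, G, hG, rfl⟩ hub
  · exact hle.trans (le_csSup ⟨D, hub⟩ ⟨k, G, hG, rfl⟩)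

theorem betagcm_eq (g c m : ℕ) (h3 : 3 ≤ g) (hgc : g ≤ c) (hcm : c ≤ m)
    (hadm : ∃ (k : ℕ) (G : SimpleGraph (Fin k)), memHclass g c m G) :
    ((g = c ∨ (g < c ∧ (c : ℝ) + (g : ℝ) / 4 ≤ (m : ℝ))) → betagcm g c m = (c : ℝ) / 4) ∧
    ((g < c ∧ (m : ℝ) < (c : ℝ) + (g : ℝ) / 4) →
      betagcm g c m = (m : ℝ) - ((g : ℝ) + 3 * (c : ℝ)) / 4) := by
  classical
  have h3c : (3 : ℝ) ≤ c := by exact_mod_cast h3.trans hgc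
  have hE : ∀ (k : ℕ) (G : SimpleGraph (Fin k)), memHclass g c m G →
      ∃ E : Finset (Sym2 (Fin k)), (∀ e, e ∈ E ↔ e ∈ G.edgeSet) ∧ E.card = m := by
    intro k G hG
    refine ⟨G.edgeSet.toFinset, fun e => Set.mem_toFinset, ?_⟩
    rw [← hG.2.2.2, Set.ncard_eq_toFinset_card']
  have hup : ∀ (k : ℕ) (G : SimpleGraph (Fin k)), memHclass g c m G → GoodD G ((c : ℝ) / 4) := by
    intro k G hG
    refine ⟨by linarith, Or.inl ?_⟩
    rw [hG.2.2.1]; linarith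
  have hbas : g < c → 1 ≤ m - c ∧ (2 * (m - c) < g → 2 * (g - (m - c)) ≤ c) := by
    intro hlt
    obtain ⟨k, G, hG⟩ := hadm
    obtain ⟨E, hE1, hE2⟩ := hE k G hG
    obtain ⟨f, hf⟩ := exists_cyc_circ (G := G) (by rw [hG.2.2.1]; omega)
    obtain ⟨z, hz⟩ := exists_cyc_girth (G := G) (by rw [hG.2.1]; omega)
    have hg := hG.2.1
    have hc := hG.2.2.1
    by_cases hk : m - c < g
    · obtain ⟨i, j, hij, hjc, hd, q1, q2, hr⟩ := shortcut (k := m - c) hE1 (by omega) hf hz (by omega) (by omega)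
      have hne : f i ≠ f j := fun he => by
        have := hf.2.2.2 i (by omega) j (by omega) he
        omega
      have := hr.pos_dist_of_ne hne
      omega
    · omega
  constructor
  · rintro (rfl | ⟨hlt, hm⟩)
    · refine beta_eq hup ?_
      obtain ⟨k, G, hG⟩ := hadm
      have : Fact G.Connected := ⟨hG.1⟩
      have := lower_girth (G := G) (by rw [hG.2.1]; omega)
      rw [hG.2.1] at this
      exact ⟨k, G, hG, this⟩
    · refine beta_eq hup ?_
      obtain ⟨b1, b2⟩ := hbas hlt
      have hm' : 4 * c + g ≤ 4 * m := by
        have : (4 * c + g : ℝ) ≤ 4 * m := by linarith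
        exact_mod_cast this
      obtain ⟨p, hp⟩ : ∃ p, p = min (m - c) (g / 2) := ⟨_, rfl⟩
      obtain ⟨q, hq⟩ : ∃ q, q = g - p := ⟨_, rfl⟩
      obtain ⟨r, hr⟩ : ∃ r, r = c - q := ⟨_, rfl⟩
      obtain ⟨e, he⟩ : ∃ e, e = m - c - p := ⟨_, rfl⟩
      have e1 : g = p + q := by omega
      have e2 : c = q + r := by omega
      have e3 : m = p + q + r + e := by omega
      have e4 : q ≤ 3 * p := by omega
      have e5 : q ≤ r := by omega
      have e6 : p ≤ q := by omega
      have e4' : (q : ℝ) ≤ 3 * p := by exact_mod_cast e4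
      clear hE hup hbas hadm
      rw [e1, e2, e3]
      refine theta_exists p q r e (by omega) e6 (by omega) e5 ?_ ?_ ?_
      · positivity
      · push_cast; linarith
      · push_cast; linarith
  · rintro ⟨hlt, hm⟩
    obtain ⟨b1, b2⟩ := hbas hlt
    have hm' : 4 * m < 4 * c + g := by
      have : 4 * (m : ℝ) < (4 * c + g : ℝ) := by linarith
      exact_mod_cast this
    have hk : ((m - c : ℕ) : ℝ) = (m : ℝ) - c := Nat.cast_sub hcm
    have hk1 : (1 : ℝ) ≤ (m : ℝ) - c := by rw [← hk]; exact_mod_cast b1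
    have hlt' : (g : ℝ) + 1 ≤ c := by exact_mod_cast hlt
    refine beta_eq ?_ ?_
    · intro k G hG
      obtain ⟨E, hE1, hE2⟩ := hE k G hG
      refine ⟨by linarith, Or.inr ⟨E, m - c, hE1, ?_, ?_, ?_, ?_, ?_⟩⟩
      · rw [hG.2.2.1]; omega
      · rw [hG.2.1]; omega
      · rw [hG.2.1, hG.2.2.1]; omega
      · rw [hG.2.1]; omega
      · rw [hG.2.1, hG.2.2.1, hk]; ring
    · obtain ⟨p, hp⟩ : ∃ p, p = m - c := ⟨_, rfl⟩
      obtain ⟨q, hq⟩ : ∃ q, q = g - p := ⟨_, rfl⟩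
      obtain ⟨r, hr⟩ : ∃ r, r = c - q := ⟨_, rfl⟩
      have e1 : g = p + q := by omega
      have e2 : c = q + r := by omega
      have e3 : m = p + q + r + 0 := by omega
      have e4 : 3 * p ≤ q := by omega
      have e5 : q ≤ r := by omega
      have e6 : p ≤ q := by omega
      have e4' : 3 * (p : ℝ) ≤ q := by exact_mod_cast e4
      have e5' : (q : ℝ) ≤ r := by exact_mod_cast e5
      have e7 : (0 : ℝ) ≤ p := by positivity
      clear hE hup hbas hadm
      rw [e1, e2, e3]
      refine theta_exists p q r 0 (by omega) e6 (by omega) e5 ?_ ?_ ?_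
      · push_cast; linarith
      · push_cast; linarith
      · push_cast; linarith
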